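/- The embedded exit Markov chain 𝒳_exit and the embedded entrance Markov chain 𝒳_entrance each have a unique stationary (invariant) probability distribution, denoted π_exit and π_entrance respectively. -/

import Mathlib

open MeasureTheory Filter
open scoped ENNReal

/-- `sigmaT ι ω = σ_{ι+1}(ω)`: the `(ι+1)`-st exit time of the radius from `ℕ`
along a trajectory `ω` in `ℤ × {1,…,m}`, i.e. `σ₁ = inf {k ≥ 0 : R(k) ≤ 0}`
and `σ_{ι+1} = inf {k > σ_ι : R(k) ≤ 0}`. -/
noncomputable def sigmaT {m : ℕ} : ℕ → (ℕ → ℤ × Fin m) → ℕ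
  | 0, ω => sInf {k : ℕ | (ω k).1 ≤ 0}
  | ι + 1, ω => sInf {k : ℕ | sigmaT ι ω < k ∧ (ω k).1 ≤ 0}

/-- The `n`-step transition probabilities of the kernel `K`. -/
noncomputable def iterK {m : ℕ} (K : ℤ × Fin m → PMF (ℤ × Fin m)) :
    ℕ → ℤ × Fin m → PMF (ℤ × Fin m)
  | 0, s => PMF.pure s
  | n + 1, s => (iterK K n s).bind K

/-- `π` is a stationary distribution of the embedded exit chain
`𝒳_exit(ι) = 𝒳(σ_ι)`: a probability distribution on the state space
`{…,−1,0} × {1,…,m}` of that chain which is invariant under its transition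
kernel (from an exit state `s` the next exit value is `ω(σ₂)` under `P s`). -/
def ExitStationary {m : ℕ} (P : ℤ × Fin m → Measure (ℕ → ℤ × Fin m))
    (π : Measure (ℤ × Fin m)) : Prop :=
  IsProbabilityMeasure π ∧ π {s : ℤ × Fin m | 1 ≤ s.1} = 0 ∧
  ∀ A : Set (ℤ × Fin m),
    ∑' s : ℤ × Fin m, π {s} * P s {ω | ω (sigmaT 1 ω) ∈ A} = π A

/-- `π` is a stationary distribution of the embedded entrance chain
`𝒳_entrance(ι) = 𝒳(τ_ι) = 𝒳(σ_ι + 1)`: a probability distribution on the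
state space `ℕ × {1,…,m}` of that chain which is invariant under its
transition kernel (from an entrance state `s` the next entrance value is
`ω(σ₁ + 1)` under `P s`). -/
def EntranceStationary {m : ℕ} (P : ℤ × Fin m → Measure (ℕ → ℤ × Fin m))
    (π : Measure (ℤ × Fin m)) : Prop :=
  IsProbabilityMeasure π ∧ π {s : ℤ × Fin m | s.1 ≤ 0} = 0 ∧
  ∀ A : Set (ℤ × Fin m),
    ∑' s : ℤ × Fin m, π {s} * P s {ω | ω (sigmaT 0 ω + 1) ∈ A} = π A


/-- two families with `f ≤ g` and equal finite sums agree -/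
lemma eq_of_le_of_tsum_eq {S : Type*} {f g : S → ℝ≥0∞} (h : ∀ s, f s ≤ g s)
    (hs : ∑' s, g s ≤ ∑' s, f s) (hfin : ∑' s, g s ≠ ⊤) : f = g := by
  by_contra hne
  obtain ⟨s, hs'⟩ := Function.ne_iff.1 hne
  have hlt : f s < g s := lt_of_le_of_ne (h s) hs'
  have h2 : ∑' s, f s < ∑' s, g s :=
    ENNReal.tsum_lt_tsum (ne_top_of_le_ne_top hfin (ENNReal.tsum_le_tsum h)) h hlt
  exact absurd hs (not_le.2 h2)

lemma tsum_push {S : Type*} {Q : S → S → ℝ≥0∞} (hQ : ∀ s, ∑' t, Q s t = 1) (p : S → ℝ≥0∞) :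
    ∑' r, ∑' s, p s * Q s r = ∑' s, p s := by
  rw [ENNReal.tsum_comm]
  refine tsum_congr fun s => ?_
  rw [ENNReal.tsum_mul_left, hQ, mul_one]

lemma stat_unique {S : Type*} (Q : S → S → ℝ≥0∞) (hQ : ∀ s, ∑' t, Q s t = 1)
    (t0 : S) (hreach : ∀ s, Relation.TransGen (fun a b => Q a b ≠ 0) s t0)
    (p p' : S → ℝ≥0∞) (hp : ∑' s, p s = 1) (hp' : ∑' s, p' s = 1)
    (hs : ∀ r, ∑' s, p s * Q s r = p r) (hs' : ∀ r, ∑' s, p' s * Q s r = p' r) : p = p' := by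
  set μ : S → ℝ≥0∞ := fun s => min (p s) (p' s) with hμ
  have hμle : ∑' s, μ s ≤ 1 := hp ▸ ENNReal.tsum_le_tsum fun s => min_le_left _ _
  have hμtop : ∑' s, μ s ≠ ⊤ := ne_top_of_le_ne_top ENNReal.one_ne_top hμle
  have hμs : (fun r => ∑' s, μ s * Q s r) = μ := by
    apply eq_of_le_of_tsum_eq
    · intro r
      apply le_min
      · rw [← hs r]
        exact ENNReal.tsum_le_tsum fun s => mul_le_mul_left (min_le_left _ _) _
      · rw [← hs' r]
        exact ENNReal.tsum_le_tsum fun s => mul_le_mul_left (min_le_right _ _) _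
    · rw [tsum_push hQ]
    · exact hμtop
  have key : ∀ q : S → ℝ≥0∞, ∑' s, q s = 1 → (∀ r, ∑' s, q s * Q s r = q r) → (∀ s, μ s ≤ q s) →
      q ≠ μ → q t0 - μ t0 ≠ 0 := by
    intro q hq hqs hle hne
    have hinv : ∀ r, ∑' s, (q s - μ s) * Q s r = q r - μ r := by
      intro r
      have h1 : ∑' s, (q s - μ s) * Q s r + μ r = q r := by
        conv_lhs => rw [← congrFun hμs r]
        rw [← ENNReal.tsum_add, ← hqs r]
        refine tsum_congr fun s => ?_
        rw [← add_mul, tsub_add_cancel_of_le (hle s)]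
      have h2 : μ r ≠ ⊤ := ne_top_of_le_ne_top hμtop (ENNReal.le_tsum r)
      rw [← h1, ENNReal.add_sub_cancel_right h2]
    obtain ⟨s, hsne⟩ := Function.ne_iff.1 hne
    have hs0 : q s - μ s ≠ 0 := by
      intro h
      exact hsne (le_antisymm (tsub_eq_zero_iff_le.1 h) (hle s))
    have step : ∀ a b, Q a b ≠ 0 → q a - μ a ≠ 0 → q b - μ b ≠ 0 := by
      intro a b hab ha hb
      rw [← hinv b, ENNReal.tsum_eq_zero] at hb
      exact mul_ne_zero ha hab (hb a)
    have : ∀ b, Relation.TransGen (fun a b => Q a b ≠ 0) s b → q b - μ b ≠ 0 := by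
      intro b hb
      induction hb with
      | single h => exact step _ _ h hs0
      | tail _ h ih => exact step _ _ h ih
    exact this t0 (hreach s)
  have hor : p t0 - μ t0 = 0 ∨ p' t0 - μ t0 = 0 := by
    rcases le_total (p t0) (p' t0) with h | h
    · left; simp [hμ, h]
    · right; simp [hμ, h]
  by_contra hne
  have main : p = μ ∨ p' = μ := by
    by_contra hcon
    push Not at hcon
    rcases hor with h | h
    · exact key p hp hs (fun s => min_le_left _ _) hcon.1 h
    · exact key p' hp' hs' (fun s => min_le_right _ _) hcon.2 h
  rcases main with h | h
  · apply hne
    apply eq_of_le_of_tsum_eq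
    · intro s; rw [h]; exact min_le_right _ _
    · rw [hp, hp']
    · rw [hp']; simp
  · apply hne
    symm
    apply eq_of_le_of_tsum_eq
    · intro s; rw [h]; exact min_le_left _ _
    · rw [hp, hp']
    · rw [hp]; simp

lemma stat_exists {S : Type*} (Q : S → S → ℝ≥0∞) (hQ : ∀ s, ∑' t, Q s t = 1)
    (V : S → ℝ≥0∞) (D : ℝ≥0∞) (hD : D ≠ ⊤)
    (hdrift : ∀ s, ∑' t, Q s t * V t ≤ V s / 2 + D)
    (hfin : ∀ M : ℝ≥0∞, M ≠ ⊤ → {s | V s ≤ M}.Finite) (s0 : S) (hs0 : V s0 ≠ ⊤) :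
    ∃ p : S → ℝ≥0∞, ∑' s, p s = 1 ∧ ∀ r, ∑' s, p s * Q s r = p r := by
  classical
  let P : ℕ → S → ℝ≥0∞ := fun n => Nat.rec (fun s => if s = s0 then 1 else 0)
    (fun _ f r => ∑' s, f s * Q s r) n
  have P0 : P 0 = fun s => if s = s0 then 1 else 0 := rfl
  have Ps : ∀ n r, P (n+1) r = ∑' s, P n s * Q s r := fun n r => rfl
  have Pmass : ∀ n, ∑' s, P n s = 1 := by
    intro n
    induction n with
    | zero => rw [P0]; simp
    | succ n ih => simp_rw [Ps]; rw [tsum_push hQ, ih]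
  set M0 : ℝ≥0∞ := V s0 + 2 * D with hM0
  have hM0t : M0 ≠ ⊤ := by
    simp only [hM0]; exact ENNReal.add_ne_top.2 ⟨hs0, ENNReal.mul_ne_top (by simp) hD⟩
  have PV : ∀ n, ∑' s, P n s * V s ≤ M0 := by
    intro n
    induction n with
    | zero =>
      rw [P0]
      simp [hM0]
    | succ n ih =>
      have : ∑' r, P (n+1) r * V r = ∑' s, P n s * ∑' r, Q s r * V r := by
        simp_rw [Ps, ← ENNReal.tsum_mul_right, ← ENNReal.tsum_mul_left]
        rw [ENNReal.tsum_comm]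
        refine tsum_congr fun s => tsum_congr fun r => by ring
      rw [this]
      calc _ ≤ ∑' s, P n s * (V s / 2 + D) :=
            ENNReal.tsum_le_tsum fun s => mul_le_mul_right (hdrift s) _
        _ = (∑' s, P n s * V s) / 2 + D := by
            simp_rw [mul_add, ENNReal.tsum_add, ENNReal.tsum_mul_right, Pmass, one_mul, div_eq_mul_inv,
              ← mul_assoc, ENNReal.tsum_mul_right]
        _ ≤ M0 / 2 + D := by gcongr
        _ ≤ M0 / 2 + M0 / 2 := by
            gcongr
            rw [ENNReal.le_div_iff_mul_le (by simp) (by simp), mul_comm]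
            exact le_add_self
        _ = M0 := ENNReal.add_halves _
  let a : ℕ → S → ℝ≥0∞ := fun n s => (∑ k ∈ Finset.range (n+1), P k s) * ((n+1 : ℕ) : ℝ≥0∞)⁻¹
  have hcancel : ∀ n : ℕ, ((n+1 : ℕ) : ℝ≥0∞) * ((n+1 : ℕ) : ℝ≥0∞)⁻¹ = 1 := fun n =>
    ENNReal.mul_inv_cancel (by simp) (by simp)
  have asum : ∀ n (f : S → ℝ≥0∞), ∑' s, a n s * f s =
      (∑ k ∈ Finset.range (n+1), ∑' s, P k s * f s) * ((n+1 : ℕ) : ℝ≥0∞)⁻¹ := by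
    intro n f
    rw [← Summable.tsum_finsetSum (fun _ _ => ENNReal.summable), ← ENNReal.tsum_mul_right]
    refine tsum_congr fun s => ?_
    simp only [a, ← Finset.sum_mul]
    ring
  have amass : ∀ n, ∑' s, a n s = 1 := by
    intro n
    have := asum n (fun _ => 1)
    simp only [mul_one, Pmass] at this
    rw [this]; simpa using hcancel n
  have aV : ∀ n, ∑' s, a n s * V s ≤ M0 := by
    intro n
    rw [asum]
    calc _ ≤ (∑ k ∈ Finset.range (n+1), M0) * ((n+1 : ℕ) : ℝ≥0∞)⁻¹ := by
          gcongr with k hk; exact PV k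
      _ = M0 * (((n+1 : ℕ) : ℝ≥0∞) * ((n+1 : ℕ) : ℝ≥0∞)⁻¹) := by simp; ring
      _ = M0 := by rw [hcancel, mul_one]
  have aQ : ∀ n r, ∑' s, a n s * Q s r ≤ a n r + ((n+1 : ℕ) : ℝ≥0∞)⁻¹ := by
    intro n r
    rw [asum]
    simp_rw [← Ps]
    have : ∑ k ∈ Finset.range (n+1), P (k+1) r ≤ ∑ k ∈ Finset.range (n+1), P k r + 1 := by
      calc _ ≤ ∑ k ∈ Finset.range (n+1), P (k+1) r + P 0 r := le_self_add
        _ = ∑ k ∈ Finset.range (n+1), P k r + P (n+1) r := by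
          rw [← Finset.sum_range_succ' (fun k => P k r), Finset.sum_range_succ]
        _ ≤ _ := by
          gcongr
          rw [← Pmass (n+1)]; exact ENNReal.le_tsum r
    calc _ ≤ (∑ k ∈ Finset.range (n+1), P k r + 1) * ((n+1 : ℕ) : ℝ≥0∞)⁻¹ := by gcongr
      _ = _ := by rw [add_mul, one_mul]
  let U : Ultrafilter ℕ := hyperfilter ℕ
  have hUle : (U : Filter ℕ) ≤ atTop := by
    rw [← Nat.cofinite_eq_atTop]; exact hyperfilter_le_cofinite
  have hlim : ∀ s, ∃ L, Tendsto (fun n => a n s) U (nhds L) := by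
    intro s
    obtain ⟨L, _, hL⟩ := isCompact_univ.ultrafilter_le_nhds (U.map (fun n => a n s)) (by simp)
    exact ⟨L, hL⟩
  choose p hp using hlim
  have hinv0 : Tendsto (fun n : ℕ => ((n+1 : ℕ) : ℝ≥0∞)⁻¹) U (nhds 0) :=
    ((tendsto_add_atTop_iff_nat 1).2 ENNReal.tendsto_inv_nat_nhds_zero).mono_left hUle
  have hQtop : ∀ s r, Q s r ≠ ⊤ := fun s r =>
    ne_top_of_le_ne_top (by simp) ((ENNReal.le_tsum r).trans_eq (hQ s))
  have sub : ∀ r, ∑' s, p s * Q s r ≤ p r := by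
    intro r
    rw [ENNReal.tsum_eq_iSup_sum]
    refine iSup_le fun F => ?_
    have h1 : Tendsto (fun n => ∑ s ∈ F, a n s * Q s r) U (nhds (∑ s ∈ F, p s * Q s r)) :=
      tendsto_finsetSum _ fun s _ => ENNReal.Tendsto.mul_const (hp s) (Or.inr (hQtop s r))
    have h2 : Tendsto (fun n : ℕ => a n r + ((n+1 : ℕ) : ℝ≥0∞)⁻¹) U (nhds (p r + 0)) :=
      (hp r).add hinv0
    rw [add_zero] at h2
    exact le_of_tendsto_of_tendsto' h1 h2 fun n => (ENNReal.sum_le_tsum F).trans (aQ n r)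
  have mle : ∑' s, p s ≤ 1 := by
    rw [ENNReal.tsum_eq_iSup_sum]
    refine iSup_le fun F => ?_
    have h1 : Tendsto (fun n => ∑ s ∈ F, a n s) U (nhds (∑ s ∈ F, p s)) :=
      tendsto_finsetSum _ fun s _ => hp s
    exact le_of_tendsto' h1 fun n => (ENNReal.sum_le_tsum F).trans (amass n).le
  have mge : ∀ M : ℕ, 1 ≤ ∑' s, p s + M0 * ((M+1:ℕ) : ℝ≥0∞)⁻¹ := by
    intro M
    let F := (hfin ((M+1:ℕ) : ℝ≥0∞) (by simp)).toFinset
    have h1 : Tendsto (fun n => ∑ s ∈ F, a n s + M0 * ((M+1:ℕ) : ℝ≥0∞)⁻¹) U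
        (nhds (∑ s ∈ F, p s + M0 * ((M+1:ℕ) : ℝ≥0∞)⁻¹)) :=
      (tendsto_finsetSum _ fun s _ => hp s).add tendsto_const_nhds
    refine (ge_of_tendsto' h1 fun n => ?_).trans (by gcongr; exact ENNReal.sum_le_tsum F)
    calc (1 : ℝ≥0∞) = ∑' s, a n s := (amass n).symm
      _ ≤ ∑' s, ((if s ∈ F then a n s else 0) + a n s * V s * ((M+1:ℕ) : ℝ≥0∞)⁻¹) := by
        refine ENNReal.tsum_le_tsum fun s => ?_
        split_ifs with h
        · exact le_self_add
        · rw [zero_add, mul_assoc]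
          have hV : ((M+1:ℕ) : ℝ≥0∞) ≤ V s := by
            by_contra hc
            exact h ((Set.Finite.mem_toFinset _).2 (not_le.1 hc).le)
          calc a n s = a n s * (((M+1:ℕ) : ℝ≥0∞) * ((M+1:ℕ) : ℝ≥0∞)⁻¹) := by
                rw [hcancel, mul_one]
            _ ≤ _ := by gcongr
      _ = ∑ s ∈ F, a n s + (∑' s, a n s * V s) * ((M+1:ℕ) : ℝ≥0∞)⁻¹ := by
        rw [ENNReal.tsum_add, ENNReal.tsum_mul_right, tsum_eq_sum (s := F)]
        · congr 1
          exact Finset.sum_congr rfl fun s hs => by simp [hs]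
        · intro s hs; simp [hs]
      _ ≤ _ := by gcongr; exact aV n
  have mge' : 1 ≤ ∑' s, p s := by
    have h0 : Tendsto (fun n : ℕ => ((n+1 : ℕ) : ℝ≥0∞)⁻¹) atTop (nhds 0) :=
      ((tendsto_add_atTop_iff_nat 1).2 ENNReal.tendsto_inv_nat_nhds_zero)
    have h1 : Tendsto (fun n : ℕ => ∑' s, p s + M0 * ((n+1 : ℕ) : ℝ≥0∞)⁻¹) atTop
        (nhds (∑' s, p s + M0 * 0)) :=
      tendsto_const_nhds.add (ENNReal.Tendsto.const_mul h0 (Or.inr hM0t))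
    rw [mul_zero, add_zero] at h1
    exact ge_of_tendsto' h1 mge
  have m1 : ∑' s, p s = 1 := le_antisymm mle mge'
  refine ⟨p, m1, fun r => ?_⟩
  have := eq_of_le_of_tsum_eq sub (by rw [tsum_push hQ]) (by rw [m1]; simp)
  exact congrFun this r


/-- tails of a convergent series are small -/
lemma tail_small (w : ℕ → ℝ≥0∞) (hw : ∑' y, w y ≠ ⊤) (η : ℝ≥0∞) (hη : η ≠ 0) :
    ∃ N : ℕ, ∑' y, (if N ≤ y then w y else 0) ≤ η := by
  have h := ENNReal.tendsto_sum_nat_add w hw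
  have h2 := (h.eventually (gt_mem_nhds (pos_iff_ne_zero.2 hη))).exists
  obtain ⟨N, hN⟩ := h2
  refine ⟨N, le_trans (le_of_eq ?_) hN.le⟩
  rw [← Summable.sum_add_tsum_nat_add' (k := N) ENNReal.summable, Finset.sum_eq_zero]
  · simp
  · intro i hi
    have := Finset.mem_range.1 hi
    simp [this]

lemma toNat_cases (x : ℤ) : (0 ≤ x ∧ (x.toNat : ℤ) = x) ∨ (x < 0 ∧ (x.toNat : ℤ) = 0) := by
  omega

lemma ar1 (x z : ℤ) (y : ℕ) (h : y < x.toNat) :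
    min (x+z).toNat y ≤ min x.toNat y := by
  have h1 := toNat_cases (x+z)
  generalize (x+z).toNat = a at *
  omega

lemma ar2 (x z : ℤ) (y : ℕ) (h : y = x.toNat) (hx : 1 ≤ x) :
    min (x+z).toNat y + (-z).toNat ≤ min x.toNat y + (-(x+z)).toNat := by
  have h1 := toNat_cases (x+z)
  have h2 := toNat_cases (-(x+z))
  generalize (x+z).toNat = a at *
  generalize (-(x+z)).toNat = b at *
  omega

lemma ar3 (x z : ℤ) (y : ℕ) (h : x.toNat < y) (hx : 1 ≤ x) :
    min (x+z).toNat y + (-z).toNat ≤ min x.toNat y + (-(x+z)).toNat + z.toNat := by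
  have h1 := toNat_cases (x+z)
  have h2 := toNat_cases (-(x+z))
  generalize (x+z).toNat = a at *
  generalize (-(x+z)).toNat = b at *
  omega

lemma drift_min (ξ : PMF ℤ) (k0 : ℝ≥0∞) (hk0 : k0 ≠ ⊤)
    (hneg : ∑' z : ℤ, ξ z * ((-z).toNat : ℝ≥0∞) = k0)
    (hpos : ∑' z : ℤ, ξ z * (z.toNat : ℝ≥0∞) = k0) (x : ℤ) (hx : 1 ≤ x) (y : ℕ) :
    ∑' z, ξ z * (min (x+z).toNat y : ℕ) + (if y = x.toNat then k0 else 0) ≤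
      (min x.toNat y : ℕ) + ∑' z, ξ z * ((-(x+z)).toNat : ℝ≥0∞) := by
  have hc : ∀ c : ℝ≥0∞, ∑' z, ξ z * c = c := fun c => by
    rw [ENNReal.tsum_mul_right, ξ.tsum_coe, one_mul]
  rcases lt_trichotomy y x.toNat with h | h | h
  · rw [if_neg (by omega), add_zero]
    refine le_trans ?_ le_self_add
    rw [← hc ((min x.toNat y : ℕ) : ℝ≥0∞)]
    refine ENNReal.tsum_le_tsum fun z => ?_
    refine mul_le_mul_right ?_ _
    exact_mod_cast ar1 x z y h
  · rw [if_pos h, ← hneg, ← hc ((min x.toNat y : ℕ) : ℝ≥0∞), ← ENNReal.tsum_add, ← ENNReal.tsum_add]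
    refine ENNReal.tsum_le_tsum fun z => ?_
    rw [← mul_add, ← mul_add]
    refine mul_le_mul_right ?_ _
    exact_mod_cast ar2 x z y h hx
  · rw [if_neg (by omega), add_zero]
    refine (ENNReal.add_le_add_iff_right hk0).1 ?_
    conv_lhs => rw [← hneg]
    conv_rhs => rw [← hpos]
    rw [← hc ((min x.toNat y : ℕ) : ℝ≥0∞), ← ENNReal.tsum_add, ← ENNReal.tsum_add,
      ← ENNReal.tsum_add]
    refine ENNReal.tsum_le_tsum fun z => ?_
    rw [← mul_add, ← mul_add, ← mul_add]
    refine mul_le_mul_right ?_ _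
    exact_mod_cast ar3 x z y h hx

/-- bounded strictly superharmonic function -/
lemma drift_u (ξ : PMF ℤ) (hk : ∑' z : ℤ, ξ z * ((-z).toNat : ℝ≥0∞) ≠ 0) :
    ∃ e : ℝ≥0∞, e ≠ 0 ∧ e ≤ 1 ∧ ∀ x : ℤ, 1 ≤ x →
      ∑' z, ξ z * (1 - e ^ (x+z).toNat) + e ^ x.toNat ≤ 1 - e ^ x.toNat := by
  obtain ⟨z0, hz0⟩ : ∃ z, ξ z * ((-z).toNat : ℝ≥0∞) ≠ 0 := by
    by_contra hcon
    push Not at hcon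
    exact hk (by simp [hcon])
  have hξ : ξ z0 ≠ 0 := left_ne_zero_of_mul hz0
  have hz : z0 ≤ -1 := by
    have := right_ne_zero_of_mul hz0
    have : (-z0).toNat ≠ 0 := by exact_mod_cast this
    omega
  have hξ1 : ξ z0 ≤ 1 := ξ.coe_le_one z0
  have hξt : ξ z0 ≠ ⊤ := ξ.apply_ne_top z0
  set e := ξ z0 / 2 with he
  have he0 : e ≠ 0 := by simp [he, hξ]
  have he1 : e ≤ 1 := ENNReal.half_le_self.trans hξ1
  have het : e ≠ ⊤ := ne_top_of_le_ne_top (by simp) he1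
  refine ⟨e, he0, he1, fun x hx => ?_⟩
  have hpt : ∀ n, e ^ n ≠ ⊤ := fun n => ENNReal.pow_ne_top het
  have hp1 : ∀ n, e ^ n ≤ 1 := fun n => pow_le_one' he1 n
  have h1 : ∑' z, ξ z * (1 - e ^ (x+z).toNat) + ∑' z, ξ z * e ^ (x+z).toNat = 1 := by
    rw [← ENNReal.tsum_add]
    refine Eq.trans ?_ ξ.tsum_coe
    refine tsum_congr fun z => ?_
    rw [← mul_add, tsub_add_cancel_of_le (hp1 _), mul_one]
  have h2 : e ^ x.toNat + e ^ x.toNat ≤ ∑' z, ξ z * e ^ (x+z).toNat := by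
    refine le_trans ?_ (ENNReal.le_tsum z0)
    have hee : ξ z0 = e + e := (ENNReal.add_halves _).symm
    have hle : e ^ (x.toNat - 1) ≤ e ^ (x + z0).toNat := pow_le_pow_right_of_le_one' he1 (by omega)
    calc e ^ x.toNat + e ^ x.toNat = ξ z0 * e ^ (x.toNat - 1) := by
          rw [hee, add_mul, ← pow_succ']
          congr <;> omega
      _ ≤ _ := by gcongr
  refine ENNReal.le_sub_of_add_le_right (hpt _) ?_
  rw [add_assoc]
  calc _ ≤ _ := add_le_add_right h2 _
    _ = 1 := h1

lemma tsum_overshoot (ξ : PMF ℤ) (hsq : ∑' z : ℤ, ξ z * ((z.natAbs ^ 2 : ℕ) : ℝ≥0∞) ≠ ⊤) :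
    ∑' x : ℕ, ∑' z : ℤ, ξ z * ((-((x:ℤ)+z)).toNat : ℝ≥0∞) ≠ ⊤ := by
  rw [ENNReal.tsum_comm]
  refine ne_top_of_le_ne_top hsq ?_
  refine ENNReal.tsum_le_tsum fun z => ?_
  rw [ENNReal.tsum_mul_left]
  gcongr
  rw [tsum_eq_sum (s := Finset.range z.natAbs)]
  · rw [← Nat.cast_sum]
    gcongr
    calc _ ≤ ∑ x ∈ Finset.range z.natAbs, z.natAbs := Finset.sum_le_sum fun i _ => by omega
      _ = _ := by simp [sq]
  · intro b hb
    simp only [Finset.mem_range, not_lt] at hb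
    have : (-((b:ℤ)+z)).toNat = 0 := by omega
    rw [this]; simp

lemma lyap (ξ : PMF ℤ) (k0 : ℝ≥0∞) (hk0 : k0 ≠ ⊤) (hk00 : k0 ≠ 0)
    (hneg : ∑' z : ℤ, ξ z * ((-z).toNat : ℝ≥0∞) = k0)
    (hpos : ∑' z : ℤ, ξ z * (z.toNat : ℝ≥0∞) = k0)
    (hsq : ∑' z : ℤ, ξ z * ((z.natAbs ^ 2 : ℕ) : ℝ≥0∞) ≠ ⊤) :
    ∃ g : ℤ → ℝ≥0∞, (∀ x, g x ≠ ⊤) ∧ (∀ x, 1 ≤ x → ∑' z, ξ z * g (x+z) < g x) ∧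
      (∀ x, x ≤ 0 → ((-x).toNat : ℝ≥0∞) ≤ 2 * g x) ∧
      (∀ η : ℝ≥0∞, η ≠ 0 → ∃ D : ℝ≥0∞, D ≠ ⊤ ∧ ∀ x, 1 ≤ x → g x ≤ η * (x.toNat : ℝ≥0∞) + D) ∧
      (∀ M : ℝ≥0∞, M ≠ ⊤ → ∃ x0 : ℤ, ∀ x, x0 ≤ x → M < g x) := by
  obtain ⟨e, he0, he1, hu⟩ := drift_u ξ (hneg ▸ hk00)
  have het : e ≠ ⊤ := ne_top_of_le_ne_top (by simp) he1
  set h : ℤ → ℝ≥0∞ := fun x => ∑' z, ξ z * ((-(x+z)).toNat : ℝ≥0∞) with hh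
  have hsum : ∑' x : ℕ, h x ≠ ⊤ := tsum_overshoot ξ hsq
  set w0 : ℕ → ℝ≥0∞ := fun y => h y / k0 + ((y^2 : ℕ) : ℝ≥0∞)⁻¹ * (if y = 0 then 0 else 1) with hw0
  have hsq2 : ∑' y : ℕ, ((y^2 : ℕ) : ℝ≥0∞)⁻¹ * (if y = 0 then 0 else 1) ≠ ⊤ := by
    have hsm : Summable (fun y : ℕ => ((y:NNReal)^2)⁻¹) := by
      rw [← NNReal.summable_coe]
      simp
    have := ENNReal.tsum_coe_ne_top_iff_summable.2 hsm
    refine ne_top_of_le_ne_top this (ENNReal.tsum_le_tsum fun y => ?_)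
    split_ifs with hy
    · simp
    · rw [mul_one, ENNReal.coe_inv (by positivity)]
      push_cast
      rfl
  have hw0s : ∑' y, w0 y ≠ ⊤ := by
    rw [hw0, ENNReal.tsum_add]
    refine ENNReal.add_ne_top.2 ⟨?_, hsq2⟩
    simp_rw [div_eq_mul_inv]
    rw [ENNReal.tsum_mul_right]
    exact ENNReal.mul_ne_top hsum (by simp [hk00])
  obtain ⟨N, hN⟩ := tail_small w0 hw0s (2⁻¹) (by simp)
  set w : ℕ → ℝ≥0∞ := fun y => if N ≤ y then w0 y else 0 with hw
  set H := ∑' y, w y with hH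
  have hHt : H ≠ ⊤ := ne_top_of_le_ne_top (by simp) hN
  have hH1 : H ≤ 1 := hN.trans (by simp)
  set B : ℝ≥0∞ := (k0 + 1) / e ^ N with hB
  have heN0 : e ^ N ≠ 0 := pow_ne_zero _ he0
  have heNt : e ^ N ≠ ⊤ := ENNReal.pow_ne_top het
  have hBt : B ≠ ⊤ := ENNReal.div_ne_top (by simp [hk0]) heN0
  have hB0 : B ≠ 0 := by
    rw [hB]; exact (ENNReal.div_ne_zero).2 ⟨by simp, heNt⟩
  set φ : ℤ → ℝ≥0∞ := fun x => ∑' y, w y * (min x.toNat y : ℕ) with hφ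
  have hφle : ∀ x, φ x ≤ H * x.toNat := by
    intro x
    rw [hH, ← ENNReal.tsum_mul_right]
    refine ENNReal.tsum_le_tsum fun y => ?_
    gcongr
    omega
  have hφt : ∀ x, φ x ≠ ⊤ := fun x =>
    ne_top_of_le_ne_top (ENNReal.mul_ne_top hHt (by simp)) (hφle x)
  set g : ℤ → ℝ≥0∞ := fun x => (1 - H) * ((-x).toNat : ℝ≥0∞) + φ x + B * (1 - e ^ x.toNat) with hg
  have hgt : ∀ x, g x ≠ ⊤ := by
    intro x
    refine ENNReal.add_ne_top.2 ⟨ENNReal.add_ne_top.2 ⟨ENNReal.mul_ne_top ?_ (by simp), hφt x⟩, ?_⟩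
    · exact ne_top_of_le_ne_top (by simp) (tsub_le_self : (1:ℝ≥0∞) - H ≤ 1)
    · exact ENNReal.mul_ne_top hBt (ne_top_of_le_ne_top (by simp) (tsub_le_self : (1:ℝ≥0∞) - e ^ x.toNat ≤ 1))
  refine ⟨g, hgt, ?_, ?_, ?_, ?_⟩
  · intro x hx
    have hhk : h x ≤ k0 := by
      rw [← hneg]
      refine ENNReal.tsum_le_tsum fun z => ?_
      gcongr
      omega
    have e1 : ∑' z, ξ z * g (x+z) =
        (1-H) * h x + ∑' z, ξ z * φ (x+z) + B * ∑' z, ξ z * (1 - e ^ (x+z).toNat) := by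
      simp only [hg, hh]
      rw [← ENNReal.tsum_mul_left, ← ENNReal.tsum_mul_left, ← ENNReal.tsum_add, ← ENNReal.tsum_add]
      refine tsum_congr fun z => by ring
    have e2 : ∑' z, ξ z * φ (x+z) + w x.toNat * k0 ≤ φ x + H * h x := by
      have : ∑' z, ξ z * φ (x+z) = ∑' y, w y * ∑' z, ξ z * (min (x+z).toNat y : ℕ) := by
        simp only [hφ, ← ENNReal.tsum_mul_left]
        rw [ENNReal.tsum_comm]
        refine tsum_congr fun y => tsum_congr fun z => by ring
      have h3 : w x.toNat * k0 = ∑' y, w y * (if y = x.toNat then k0 else 0) := by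
        rw [tsum_eq_single x.toNat]
        · simp
        · intro b hb; simp [hb]
      rw [this, h3, ← ENNReal.tsum_add, hH, ← ENNReal.tsum_mul_right, ← ENNReal.tsum_add]
      refine ENNReal.tsum_le_tsum fun y => ?_
      rw [← mul_add, ← mul_add]
      refine mul_le_mul_right ?_ _
      exact drift_min ξ k0 hk0 hneg hpos x hx y
    have e3 := hu x hx
    have hex0 : e ^ x.toNat ≠ 0 := pow_ne_zero _ he0
    have hext : e ^ x.toNat ≠ ⊤ := ENNReal.pow_ne_top het
    have e4 : h x < w x.toNat * k0 + B * e ^ x.toNat := by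
      by_cases hxN : N ≤ x.toNat
      · have hxc : ((x.toNat : ℕ) : ℤ) = x := by omega
        have : h x ≤ w x.toNat * k0 := by
          simp only [hw, if_pos hxN, hw0, hxc]
          rw [add_mul, ENNReal.div_mul_cancel hk00 hk0]
          exact le_self_add
        calc h x < h x + B * e ^ x.toNat :=
              ENNReal.lt_add_right (ne_top_of_le_ne_top hk0 hhk) (mul_ne_zero hB0 hex0)
          _ ≤ _ := by gcongr
      · have : e ^ N ≤ e ^ x.toNat := pow_le_pow_right_of_le_one' he1 (by omega)
        calc h x ≤ k0 := hhk
          _ < k0 + 1 := ENNReal.lt_add_right hk0 (by simp)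
          _ = B * e ^ N := (ENNReal.div_mul_cancel heN0 heNt).symm
          _ ≤ B * e ^ x.toNat := by gcongr
          _ ≤ _ := le_add_self
    have hx0 : (-x).toNat = 0 := by omega
    have e5 : (1 - H) * h x + H * h x = h x := by
      rw [← add_mul, tsub_add_cancel_of_le hH1, one_mul]
    rw [e1]
    have hwt : w x.toNat ≠ ⊤ := ne_top_of_le_ne_top hHt (ENNReal.le_tsum _)
    have hct : w x.toNat * k0 + B * e ^ x.toNat ≠ ⊤ :=
      ENNReal.add_ne_top.2 ⟨ENNReal.mul_ne_top hwt hk0, ENNReal.mul_ne_top hBt hext⟩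
    refine (ENNReal.add_lt_add_iff_right hct).1 ?_
    calc _ = (1-H) * h x + (∑' z, ξ z * φ (x+z) + w x.toNat * k0) +
          B * (∑' z, ξ z * (1 - e ^ (x+z).toNat) + e ^ x.toNat) := by ring
      _ ≤ (1-H) * h x + (φ x + H * h x) + B * (1 - e ^ x.toNat) := by gcongr
      _ = ((1-H) * h x + H * h x) + (φ x + B * (1 - e ^ x.toNat)) := by ring
      _ = h x + (φ x + B * (1 - e ^ x.toNat)) := by rw [e5]
      _ = h x + g x := by simp [hg, hx0]
      _ < (w x.toNat * k0 + B * e ^ x.toNat) + g x := ENNReal.add_lt_add_right (hgt x) e4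
      _ = _ := add_comm _ _
  · intro x hx
    have h2 : (1:ℝ≥0∞) ≤ 2 * (1 - H) := by
      rw [ENNReal.mul_sub (by simp)]
      refine ENNReal.le_sub_of_add_le_right (ENNReal.mul_ne_top (by simp) hHt) ?_
      calc 1 + 2 * H ≤ 1 + 2 * 2⁻¹ := by gcongr
        _ = 2 * 1 := by rw [ENNReal.mul_inv_cancel (by simp) (by simp)]; norm_num
    calc ((-x).toNat : ℝ≥0∞) = 1 * ((-x).toNat : ℝ≥0∞) := (one_mul _).symm
      _ ≤ (2 * (1 - H)) * ((-x).toNat : ℝ≥0∞) := by gcongr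
      _ ≤ _ := by
        rw [mul_assoc]
        gcongr
        simp only [hg, add_assoc]
        exact le_self_add
  · intro η hη
    obtain ⟨L, hL⟩ := tail_small w hHt η hη
    refine ⟨H * L + B, ENNReal.add_ne_top.2 ⟨ENNReal.mul_ne_top hHt (by simp), hBt⟩, fun x hx => ?_⟩
    have hx0 : (-x).toNat = 0 := by omega
    have hφ2 : φ x ≤ η * x.toNat + H * L := by
      calc φ x ≤ ∑' y, ((if L ≤ y then w y else 0) * x.toNat + w y * L) := by
            refine ENNReal.tsum_le_tsum fun y => ?_
            split_ifs with hy
            · refine le_trans ?_ le_self_add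
              gcongr
              omega
            · refine le_trans ?_ le_add_self
              gcongr
              omega
        _ = (∑' y, (if L ≤ y then w y else 0)) * x.toNat + H * L := by
          rw [ENNReal.tsum_add, ENNReal.tsum_mul_right, ENNReal.tsum_mul_right]
        _ ≤ _ := by gcongr
    simp only [hg, hx0, Nat.cast_zero, mul_zero, zero_add]
    calc _ ≤ (η * x.toNat + H * L) + B * 1 := by gcongr; exact tsub_le_self
      _ = _ := by ring
  · intro M hM
    have hdiv : ∑' y, w y * (y : ℝ≥0∞) = ⊤ := by
      by_contra hcon
      have hns := Real.not_summable_natCast_inv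
      apply hns
      have h1 : Summable (fun y : ℕ => ((y:NNReal))⁻¹) := by
        rw [← NNReal.summable_nat_add_iff (N+1), ← ENNReal.tsum_coe_ne_top_iff_summable]
        refine ne_top_of_le_ne_top hcon ?_
        calc _ ≤ ∑' y : ℕ, w (y + (N+1)) * ((y + (N+1) : ℕ) : ℝ≥0∞) := by
              refine ENNReal.tsum_le_tsum fun y => ?_
              simp only [hw, if_pos (show N ≤ y + (N+1) by omega), hw0]
              rw [if_neg (by omega), mul_one, add_mul]
              refine le_trans (le_of_eq ?_) le_add_self
              set a : ℕ := y + (N+1) with ha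
              have ha0 : (a:ℝ≥0∞) ≠ 0 := by simp [ha]
              rw [ENNReal.coe_inv (by simp [ha])]
              push_cast
              rw [sq, ENNReal.mul_inv (by simp) (by simp), mul_assoc,
                ENNReal.inv_mul_cancel ha0 (by simp), mul_one]
          _ ≤ _ := by
            rw [← Summable.sum_add_tsum_nat_add' (k := N+1) (f := fun y : ℕ => w y * (y : ℝ≥0∞))
              ENNReal.summable]
            exact le_add_self
      have := NNReal.summable_coe.2 h1
      simpa using this
    have : M < ⨆ F : Finset ℕ, ∑ y ∈ F, w y * (y : ℝ≥0∞) := by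
      rw [← ENNReal.tsum_eq_iSup_sum, hdiv]; exact hM.lt_top
    obtain ⟨F, hF⟩ := lt_iSup_iff.1 this
    refine ⟨((F.sup id : ℕ) : ℤ), fun x hx => hF.trans_le ?_⟩
    calc _ ≤ ∑ y ∈ F, w y * (min x.toNat y : ℕ) := by
          refine Finset.sum_le_sum fun y hy => ?_
          have : y ≤ F.sup id := Finset.le_sup (f := id) hy
          gcongr
          omega
      _ ≤ φ x := ENNReal.sum_le_tsum F
      _ ≤ _ := by
        simp only [hg]
        rw [add_right_comm]
        exact le_add_self

/-- Expected payoff `f` collected at the exit time when exiting exactly at time `n`. -/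
noncomputable def exN {m : ℕ} (K : ℤ × Fin m → PMF (ℤ × Fin m)) (f : ℤ × Fin m → ℝ≥0∞) :
    ℕ → ℤ × Fin m → ℝ≥0∞
  | 0, s => if s.1 ≤ 0 then f s else 0
  | n + 1, s => if s.1 ≤ 0 then 0 else ∑' t, K s t * exN K f n t

/-- Expected payoff `f` collected at the exit time. -/
noncomputable def Ex {m : ℕ} (K : ℤ × Fin m → PMF (ℤ × Fin m)) (f : ℤ × Fin m → ℝ≥0∞)
    (s : ℤ × Fin m) : ℝ≥0∞ := ∑' n, exN K f n s

lemma Ex_nonpos {m : ℕ} (K : ℤ × Fin m → PMF (ℤ × Fin m)) (f : ℤ × Fin m → ℝ≥0∞)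
    (s : ℤ × Fin m) (hs : s.1 ≤ 0) : Ex K f s = f s := by
  rw [Ex, tsum_eq_single 0]
  · simp [exN, hs]
  · intro n hn
    cases n with
    | zero => exact absurd rfl hn
    | succ n => simp [exN, hs]

lemma Ex_pos {m : ℕ} (K : ℤ × Fin m → PMF (ℤ × Fin m)) (f : ℤ × Fin m → ℝ≥0∞)
    (s : ℤ × Fin m) (hs : 1 ≤ s.1) : Ex K f s = ∑' t, K s t * Ex K f t := by
  have hs' : ¬ s.1 ≤ 0 := by omega
  rw [Ex, tsum_eq_zero_add' ENNReal.summable]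
  simp only [exN, hs', if_false, zero_add, Ex, ← ENNReal.tsum_mul_left]
  rw [ENNReal.tsum_comm]

lemma exN_tsum {m : ℕ} (K : ℤ × Fin m → PMF (ℤ × Fin m)) {I : Type*} (c : I → ℝ≥0∞)
    (F : I → ℤ × Fin m → ℝ≥0∞) (n : ℕ) (s : ℤ × Fin m) :
    exN K (fun u => ∑' i, c i * F i u) n s = ∑' i, c i * exN K (F i) n s := by
  induction n generalizing s with
  | zero => by_cases h : s.1 ≤ 0 <;> simp [exN, h]
  | succ n ih =>
    by_cases h : s.1 ≤ 0
    · simp [exN, h]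
    · simp only [exN, h, if_false, ih, ← ENNReal.tsum_mul_left]
      rw [ENNReal.tsum_comm]
      refine tsum_congr fun i => tsum_congr fun t => by ring

lemma Ex_tsum {m : ℕ} (K : ℤ × Fin m → PMF (ℤ × Fin m)) {I : Type*} (c : I → ℝ≥0∞)
    (F : I → ℤ × Fin m → ℝ≥0∞) (s : ℤ × Fin m) :
    Ex K (fun u => ∑' i, c i * F i u) s = ∑' i, c i * Ex K (F i) s := by
  simp only [Ex, exN_tsum, ← ENNReal.tsum_mul_left]
  rw [ENNReal.tsum_comm]

/-- indicator of a point -/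
noncomputable def dl {S : Type*} (u v : S) : ℝ≥0∞ := by
  classical exact if v = u then 1 else 0

lemma tsum_dl {S : Type*} (f : S → ℝ≥0∞) (v : S) : ∑' u, f u * dl u v = f v := by
  classical
  rw [tsum_eq_single v]
  · simp [dl]
  · intro b hb; simp [dl, hb.symm]

lemma Ex_expand {m : ℕ} (K : ℤ × Fin m → PMF (ℤ × Fin m))
    (f : ℤ × Fin m → ℝ≥0∞) (s : ℤ × Fin m) :
    Ex K f s = ∑' u, f u * Ex K (dl u) s := by
  rw [← Ex_tsum]
  congr 1
  funext v
  exact (tsum_dl f v).symm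

lemma Ex_min {m : ℕ} (K : ℤ × Fin m → PMF (ℤ × Fin m)) (f W : ℤ × Fin m → ℝ≥0∞)
    (h1 : ∀ s, s.1 ≤ 0 → f s ≤ W s) (h2 : ∀ s, 1 ≤ s.1 → ∑' t, K s t * W t ≤ W s)
    (s : ℤ × Fin m) : Ex K f s ≤ W s := by
  rw [Ex, ENNReal.tsum_eq_iSup_nat]
  refine iSup_le fun n => ?_
  induction n generalizing s with
  | zero => simp
  | succ n ih =>
    rw [Finset.sum_range_succ']
    by_cases h : s.1 ≤ 0
    · simpa [exN, h] using h1 s h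
    · simp only [exN, h, if_false, add_zero]
      rw [← Summable.tsum_finsetSum (fun _ _ => ENNReal.summable)]
      refine le_trans (ENNReal.tsum_le_tsum fun t => ?_) (h2 s (by omega))
      rw [← Finset.mul_sum]
      exact mul_le_mul_right (ih t) _

lemma K_sum {m : ℕ} (K : ℤ × Fin m → PMF (ℤ × Fin m)) (ξ : Fin m → PMF ℤ)
    (hA1 : ∀ x : ℤ, 1 ≤ x → ∀ (i : Fin m) (y : ℤ), K (x, i) (x + y, i) = ξ i y)
    (x : ℤ) (hx : 1 ≤ x) (i : Fin m) (f : ℤ × Fin m → ℝ≥0∞) :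
    ∑' t, K (x, i) t * f t = ∑' y, ξ i y * f (x + y, i) := by
  classical
  have hinj : Function.Injective (fun y : ℤ => ((x + y, i) : ℤ × Fin m)) := by
    intro a b hab
    simpa using hab
  have hz : ∀ t, t ∉ Set.range (fun y : ℤ => ((x + y, i) : ℤ × Fin m)) → K (x, i) t = 0 := by
    have : (fun t => Set.indicator (Set.range (fun y : ℤ => ((x + y, i) : ℤ × Fin m)))
        (fun t => K (x, i) t) t) = fun t => K (x, i) t := by
      apply eq_of_le_of_tsum_eq
      · intro t; exact Set.indicator_le_self _ _ _
      · rw [PMF.tsum_coe]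
        rw [← hinj.tsum_eq]
        · have : ∀ y, Set.indicator (Set.range (fun y : ℤ => ((x + y, i) : ℤ × Fin m)))
            (fun t => K (x, i) t) (x + y, i) = ξ i y := by
            intro y
            rw [Set.indicator_of_mem (Set.mem_range_self (f := fun y : ℤ => ((x + y, i) : ℤ × Fin m)) y), hA1 x hx]
          simp_rw [this]
          rw [PMF.tsum_coe]
        · exact Set.support_indicator_subset
      · rw [PMF.tsum_coe]; simp
    intro t ht
    have h2 := congrFun this t
    rw [← h2, Set.indicator_of_notMem ht]
  rw [← hinj.tsum_eq]
  · simp_rw [hA1 x hx]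
  · intro t ht
    by_contra hc
    exact ht (by simp [hz t hc])

lemma max_principle (ξ : PMF ℤ) (g h : ℤ → ℝ≥0∞) (hgt : ∀ x, g x ≠ ⊤)
    (hg : ∀ x, 1 ≤ x → ∑' z, ξ z * g (x+z) < g x)
    (hginf : ∀ M : ℝ≥0∞, M ≠ ⊤ → ∃ x0 : ℤ, ∀ x, x0 ≤ x → M < g x)
    (h1 : ∀ x, h x ≤ 1) (h0 : ∀ x, x ≤ 0 → h x = 0)
    (hh : ∀ x, 1 ≤ x → h x ≤ ∑' z, ξ z * h (x+z)) (x : ℤ) : h x = 0 := by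
  by_contra hx
  have hx1 : 1 ≤ x := by
    by_contra hc
    exact hx (h0 x (by omega))
  have hht : ∀ x, h x ≠ ⊤ := fun x => ne_top_of_le_ne_top (by simp) (h1 x)
  have hpos : 0 < (h x).toReal := ENNReal.toReal_pos hx (hht x)
  obtain ⟨ε, hε, hε2⟩ : ∃ ε : ℝ, 0 < ε ∧ ε * (g x).toReal < (h x).toReal := by
    refine ⟨(h x).toReal / ((g x).toReal + 1), by positivity, ?_⟩
    have hg0 : 0 ≤ (g x).toReal := ENNReal.toReal_nonneg
    rw [div_mul_eq_mul_div, div_lt_iff₀ (by positivity)]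
    nlinarith
  obtain ⟨x0, hx0⟩ := hginf (ENNReal.ofReal (1/ε)) (by simp)
  let F : ℤ → ℝ := fun x => (h x).toReal - ε * (g x).toReal
  have hFx : 0 < F x := by simp only [F]; linarith
  have hxmem : x ∈ Finset.Icc 1 (max x0 x) := by simp [hx1]
  obtain ⟨xs, hxs, hmax⟩ := Finset.exists_max_image (Finset.Icc 1 (max x0 x)) F ⟨x, hxmem⟩
  have hFs : 0 < F xs := hFx.trans_le (hmax x hxmem)
  have hall : ∀ y, F y ≤ F xs := by
    intro y
    by_cases hy : y ∈ Finset.Icc 1 (max x0 x)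
    · exact hmax y hy
    · refine le_trans ?_ hFs.le
      have hgn : 0 ≤ (g y).toReal := ENNReal.toReal_nonneg
      by_cases hy0 : y ≤ 0
      · simp only [F, h0 y hy0, ENNReal.toReal_zero]
        nlinarith
      · have hyx : x0 ≤ y := by
          by_contra hc
          exact hy (by simp only [Finset.mem_Icc, le_max_iff]; omega)
        have h2 := hx0 y hyx
        have h3 : 1/ε < (g y).toReal := (ENNReal.ofReal_lt_iff_lt_toReal (by positivity) (hgt y)).1 h2
        have h4 : (h y).toReal ≤ 1 := by
          have := ENNReal.toReal_mono (by simp) (h1 y)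
          simpa using this
        rw [div_lt_iff₀ hε] at h3
        simp only [F]
        linarith
  have hle : ∀ y, h y ≤ ENNReal.ofReal (F xs) + ENNReal.ofReal ε * g y := by
    intro y
    have : (h y).toReal ≤ F xs + ε * (g y).toReal := by
      have := hall y; simp only [F] at this ⊢; linarith
    rw [← ENNReal.ofReal_toReal (hht y)]
    refine (ENNReal.ofReal_le_ofReal this).trans ?_
    rw [ENNReal.ofReal_add hFs.le (by positivity), ENNReal.ofReal_mul hε.le,
      ENNReal.ofReal_toReal (hgt y)]
  have heq : h xs = ENNReal.ofReal (F xs) + ENNReal.ofReal ε * g xs := by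
    rw [← ENNReal.ofReal_toReal (hgt xs), ← ENNReal.ofReal_mul hε.le,
      ← ENNReal.ofReal_add hFs.le (by positivity), ← ENNReal.ofReal_toReal (hht xs)]
    congr 1
    simp only [F]; ring
  have hxs1 : 1 ≤ xs := (Finset.mem_Icc.1 hxs).1
  have hlt : h xs < h xs := by
    calc h xs ≤ ∑' z, ξ z * h (xs+z) := hh xs hxs1
      _ ≤ ∑' z, ξ z * (ENNReal.ofReal (F xs) + ENNReal.ofReal ε * g (xs+z)) :=
        ENNReal.tsum_le_tsum fun z => mul_le_mul_right (hle _) _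
      _ = ENNReal.ofReal (F xs) + ENNReal.ofReal ε * ∑' z, ξ z * g (xs+z) := by
        simp_rw [mul_add, ENNReal.tsum_add, ENNReal.tsum_mul_right, ξ.tsum_coe, one_mul,
          mul_left_comm, ENNReal.tsum_mul_left]
      _ < ENNReal.ofReal (F xs) + ENNReal.ofReal ε * g xs := by
        refine ENNReal.add_lt_add_left (by simp) ?_
        exact ENNReal.mul_lt_mul_right (by simpa using hε) (by simp) (hg xs hxs1)
      _ = h xs := heq.symm
  exact lt_irrefl _ hlt

lemma Ex_one {m : ℕ} (K : ℤ × Fin m → PMF (ℤ × Fin m)) (ξ : Fin m → PMF ℤ)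
    (hA1 : ∀ x : ℤ, 1 ≤ x → ∀ (i : Fin m) (y : ℤ), K (x, i) (x + y, i) = ξ i y)
    (g : Fin m → ℤ → ℝ≥0∞) (hgt : ∀ i x, g i x ≠ ⊤)
    (hg : ∀ i x, 1 ≤ x → ∑' z, ξ i z * g i (x+z) < g i x)
    (hginf : ∀ i, ∀ M : ℝ≥0∞, M ≠ ⊤ → ∃ x0 : ℤ, ∀ x, x0 ≤ x → M < g i x)
    (s : ℤ × Fin m) : Ex K (fun _ => 1) s = 1 := by
  have hle : ∀ s, Ex K (fun _ => 1) s ≤ 1 := fun s =>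
    Ex_min K (fun _ => 1) (fun _ => 1) (fun _ _ => le_rfl) (fun s _ => by simp [PMF.tsum_coe]) s
  obtain ⟨x, i⟩ := s
  have := max_principle (ξ i) (g i) (fun x => 1 - Ex K (fun _ => 1) (x, i)) (hgt i) (hg i) (hginf i)
    (fun x => tsub_le_self) (fun x hx => by rw [Ex_nonpos _ _ _ hx]; simp) (fun x hx => by
      rw [Ex_pos _ _ _ hx, K_sum K ξ hA1 x hx i]
      rw [tsub_le_iff_right, ← ENNReal.tsum_add]
      refine le_of_eq ((ξ i).tsum_coe.symm.trans (tsum_congr fun z => ?_))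
      rw [← mul_add, tsub_add_cancel_of_le (hle _), mul_one]) x
  exact le_antisymm (hle _) (tsub_eq_zero_iff_le.1 this)

/-- shift of a path -/
def sh {S : Type*} (ω : ℕ → S) : ℕ → S := fun k => ω (k + 1)

lemma measurable_sh {S : Type*} [MeasurableSpace S] : Measurable (sh (S := S)) :=
  measurable_pi_lambda _ fun k => measurable_pi_apply (k+1)

lemma gen_cyl {S : Type*} [MeasurableSpace S] [Countable S] [MeasurableSingletonClass S] :
    (MeasurableSpace.pi : MeasurableSpace (ℕ → S)) =
      MeasurableSpace.generateFrom {A | ∃ (n : ℕ) (path : ℕ → S), A = {ω | ∀ k ≤ n, ω k = path k}} := by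
  apply le_antisymm
  · refine iSup_le fun k => ?_
    rw [← measurable_iff_comap_le]
    refine @measurable_to_countable' _ _ _ _ (_) _ fun a => ?_
    have : (fun ω : ℕ → S => ω k) ⁻¹' {a} = ⋃ c : {c : Fin (k+1) → S // c (Fin.last k) = a},
        {ω | ∀ j ≤ k, ω j = (fun j => if h : j < k+1 then c.1 ⟨j, h⟩ else a) j} := by
      ext ω
      simp only [Set.mem_preimage, Set.mem_singleton_iff, Set.mem_iUnion, Set.mem_ofPred_eq]
      constructor
      · intro h
        refine ⟨⟨fun j => ω j, h⟩, fun j hj => ?_⟩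
        simp [show j < k + 1 by omega]
      · rintro ⟨c, hc⟩
        rw [hc k le_rfl, dif_pos (by omega)]
        exact c.2
    rw [this]
    refine MeasurableSet.iUnion fun c => ?_
    exact MeasurableSpace.measurableSet_generateFrom ⟨k, _, rfl⟩
  · refine MeasurableSpace.generateFrom_le ?_
    rintro A ⟨n, path, rfl⟩
    have : {ω : ℕ → S | ∀ k ≤ n, ω k = path k} = ⋂ k, ⋂ (_ : k ≤ n), (fun ω : ℕ → S => ω k) ⁻¹' {path k} := by
      ext ω; simp
    rw [this]
    exact MeasurableSet.iInter fun k => MeasurableSet.iInter fun _ =>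
      measurable_pi_apply k (measurableSet_singleton _)

lemma pi_cyl {S : Type*} :
    IsPiSystem {A : Set (ℕ → S) | ∃ (n : ℕ) (path : ℕ → S), A = {ω | ∀ k ≤ n, ω k = path k}} := by
  rintro _ ⟨n, p, rfl⟩ _ ⟨n', p', rfl⟩ ⟨ω, h1, h2⟩
  refine ⟨max n n', ω, ?_⟩
  ext η
  simp only [Set.mem_inter_iff, Set.mem_ofPred_eq] at *
  constructor
  · rintro ⟨a, b⟩ k hk
    rcases le_max_iff.1 hk with h | h
    · rw [a k h, h1 k h]
    · rw [b k h, h2 k h]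
  · intro a
    exact ⟨fun k hk => by rw [a k (le_max_of_le_left hk), h1 k hk],
      fun k hk => by rw [a k (le_max_of_le_right hk), h2 k hk]⟩

section markov
variable {m : ℕ} (K : ℤ × Fin m → PMF (ℤ × Fin m))
    (P : ℤ × Fin m → Measure (ℕ → ℤ × Fin m))
    (hprob : ∀ s, IsProbabilityMeasure (P s))
    (hcyl : ∀ (s : ℤ × Fin m) (n : ℕ) (path : ℕ → ℤ × Fin m),
      P s {ω | ∀ k ≤ n, ω k = path k} =
        (if path 0 = s then 1 else 0) *
          ∏ k ∈ Finset.range n, K (path k) (path (k + 1)))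
include hprob hcyl

lemma ae0 (s : ℤ × Fin m) : ∀ᵐ ω ∂(P s), ω 0 = s := by
  have h := hcyl s 0 (fun _ => s)
  have hm : MeasurableSet ((fun ω : ℕ → ℤ × Fin m => ω 0) ⁻¹' {s}) :=
    measurable_pi_apply 0 (measurableSet_singleton s)
  have := hprob s
  have h2 : P s {ω : ℕ → ℤ × Fin m | ω 0 = s} = 1 := by simpa using h
  exact (prob_compl_eq_zero_iff hm).2 h2

lemma markov (s : ℤ × Fin m) (F : Set (ℕ → ℤ × Fin m)) (hF : MeasurableSet F) :
    P s (sh ⁻¹' F) = ∑' t, K s t * P t F := by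
  have : (P s).map sh = Measure.sum (fun t => K s t • P t) := by
    have := hprob s
    have : IsProbabilityMeasure ((P s).map sh) :=
      Measure.isProbabilityMeasure_map measurable_sh.aemeasurable
    refine ext_of_generate_finite _ gen_cyl pi_cyl ?_ ?_
    · rintro A ⟨n, path, rfl⟩
      have hA : MeasurableSet {ω : ℕ → ℤ × Fin m | ∀ k ≤ n, ω k = path k} := by
        rw [gen_cyl]; exact MeasurableSpace.measurableSet_generateFrom ⟨n, path, rfl⟩
      rw [Measure.map_apply measurable_sh hA, Measure.sum_apply _ hA]
      simp only [Measure.smul_apply, smul_eq_mul, hcyl]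
      have e1 : P s (sh ⁻¹' {ω | ∀ k ≤ n, ω k = path k}) =
          P s {ω | ∀ k ≤ n+1, ω k = (fun k => Nat.casesOn k s path : ℕ → ℤ × Fin m) k} := by
        apply measure_congr
        filter_upwards [ae0 K P hprob hcyl s] with ω hω
        apply propext
        change (∀ k ≤ n, ω (k+1) = path k) ↔ (∀ k ≤ n+1, ω k = (fun k => Nat.casesOn k s path : ℕ → ℤ × Fin m) k)
        constructor
        · intro h k hk
          cases k with
          | zero => exact hω
          | succ k => exact h k (by omega)
        · intro h k hk
          exact h (k+1) (by omega)
      rw [e1, hcyl, Finset.prod_range_succ', tsum_eq_single (path 0)]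
      · simp [mul_comm]
      · intro b hb; simp [hb.symm]
    · rw [measure_univ, Measure.sum_apply _ MeasurableSet.univ]
      simp only [Measure.smul_apply, smul_eq_mul]
      have : ∀ t, P t Set.univ = 1 := fun t => (hprob t).measure_univ
      simp [this, PMF.tsum_coe]
  rw [← Measure.map_apply measurable_sh hF, this, Measure.sum_apply _ hF]
  simp

omit hprob hcyl in
/-- first exit at time `n` and afterwards the path is in `T` -/
def EvN (n : ℕ) (T : Set (ℕ → ℤ × Fin m)) : Set (ℕ → ℤ × Fin m) :=
  {ω | (∀ k < n, 1 ≤ (ω k).1) ∧ (ω n).1 ≤ 0 ∧ (fun k => ω (k + n)) ∈ T}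

omit hprob hcyl in
lemma measurable_EvN (n : ℕ) (T : Set (ℕ → ℤ × Fin m)) (hT : MeasurableSet T) :
    MeasurableSet (EvN n T) := by
  have h1 : ∀ (k : ℕ) (B : Set (ℤ × Fin m)), MeasurableSet {ω : ℕ → ℤ × Fin m | ω k ∈ B} :=
    fun k B => measurable_pi_apply k (MeasurableSet.of_discrete)
  have : EvN n T = (⋂ k, ⋂ (_ : k < n), {ω | ω k ∈ {s : ℤ × Fin m | 1 ≤ s.1}}) ∩
      ({ω | ω n ∈ {s : ℤ × Fin m | s.1 ≤ 0}} ∩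
      (fun (ω : ℕ → ℤ × Fin m) k => ω (k + n)) ⁻¹' T) := by
    ext ω; simp [EvN]
  rw [this]
  refine (MeasurableSet.iInter fun k => MeasurableSet.iInter fun _ => h1 _ _).inter
    ((h1 _ _).inter ?_)
  exact (measurable_pi_lambda _ fun k => measurable_pi_apply (k+n)) hT

lemma P_EvN (T : Set (ℕ → ℤ × Fin m)) (hT : MeasurableSet T) (n : ℕ) (s : ℤ × Fin m) :
    P s (EvN n T) = exN K (fun u => P u T) n s := by
  induction n generalizing s with
  | zero =>
    by_cases h : s.1 ≤ 0
    · simp only [exN, h, if_true]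
      apply measure_congr
      filter_upwards [ae0 K P hprob hcyl s] with ω hω
      apply propext
      change (_ ∧ _ ∧ _) ↔ ω ∈ T
      simp [hω, h]
    · simp only [exN, h, if_false]
      rw [measure_eq_zero_iff_ae_notMem]
      filter_upwards [ae0 K P hprob hcyl s] with ω hω
      simp [EvN, hω, h]
  | succ n ih =>
    by_cases h : s.1 ≤ 0
    · simp only [exN, h, if_true]
      rw [measure_eq_zero_iff_ae_notMem]
      filter_upwards [ae0 K P hprob hcyl s] with ω hω hmem
      have := hmem.1 0 (by omega)
      rw [hω] at this
      omega
    · simp only [exN, h, if_false]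
      simp_rw [← ih]
      rw [← markov K P hprob hcyl s _ (measurable_EvN n T hT)]
      apply measure_congr
      filter_upwards [ae0 K P hprob hcyl s] with ω hω
      apply propext
      change ((∀ k < n+1, 1 ≤ (ω k).1) ∧ (ω (n+1)).1 ≤ 0 ∧ (fun k => ω (k + (n+1))) ∈ T) ↔
        ((∀ k < n, 1 ≤ (ω (k+1)).1) ∧ (ω (n+1)).1 ≤ 0 ∧ (fun k => ω (k + n + 1)) ∈ T)
      refine and_congr_left fun _ => ?_
      constructor
      · intro hk k hkn; exact hk (k+1) (by omega)
      · intro hk k hkn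
        cases k with
        | zero => rw [hω]; omega
        | succ k => exact hk k (by omega)

omit hprob hcyl in
lemma EvN_disj (T : Set (ℕ → ℤ × Fin m)) : Pairwise (Function.onFun Disjoint (fun n => EvN n T)) := by
  intro a b hab
  rw [Function.onFun, Set.disjoint_left]
  rintro ω ⟨h1, h2, _⟩ ⟨h3, h4, _⟩
  rcases lt_or_gt_of_ne hab with h | h
  · have := h3 a h; omega
  · have := h1 b h; omega

lemma P_Ev (T : Set (ℕ → ℤ × Fin m)) (hT : MeasurableSet T) (s : ℤ × Fin m) :
    P s (⋃ n, EvN n T) = Ex K (fun u => P u T) s := by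
  rw [measure_iUnion (EvN_disj T) (fun n => measurable_EvN n T hT), Ex]
  simp_rw [P_EvN K P hprob hcyl T hT]

lemma exit_ae (hone : ∀ s, Ex K (fun _ => 1) s = 1) (s : ℤ × Fin m) :
    ∀ᵐ ω ∂(P s), ω ∈ ⋃ n, EvN n Set.univ := by
  have h := P_Ev K P hprob hcyl Set.univ MeasurableSet.univ s
  have hu : ∀ u, P u Set.univ = 1 := fun u => (hprob u).measure_univ
  simp only [hu, hone] at h
  have := hprob s
  exact (prob_compl_eq_zero_iff (MeasurableSet.iUnion fun n =>
    measurable_EvN n _ MeasurableSet.univ)).2 h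

omit hprob hcyl in
lemma sigma0_eq (ω : ℕ → ℤ × Fin m) (n : ℕ) (h1 : ∀ k < n, 1 ≤ (ω k).1) (h2 : (ω n).1 ≤ 0) :
    sigmaT 0 ω = n := by
  rw [sigmaT]
  apply le_antisymm
  · exact Nat.sInf_le h2
  · refine le_csInf ⟨n, h2⟩ fun k hk => ?_
    by_contra hc
    have := h1 k (by omega)
    simp only [Set.mem_ofPred_eq] at hk
    omega

omit hprob hcyl in
lemma sigma1_eq (ω : ℕ → ℤ × Fin m) (n : ℕ) (h0 : (ω 0).1 ≤ 0) (h1 : ∀ k < n, 1 ≤ (sh ω k).1)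
    (h2 : (sh ω n).1 ≤ 0) : sigmaT 1 ω = n + 1 := by
  have hz : sigmaT 0 ω = 0 := sigma0_eq ω 0 (by simp) h0
  rw [sigmaT, hz]
  apply le_antisymm
  · exact Nat.sInf_le ⟨by omega, h2⟩
  · refine le_csInf ⟨n+1, by omega, h2⟩ ?_
    rintro k ⟨hk0, hk⟩
    by_contra hc
    have := h1 (k-1) (by omega)
    rw [sh, show k - 1 + 1 = k by omega] at this
    omega

/-- law of the entrance chain -/
lemma entrance_law (hone : ∀ s, Ex K (fun _ => 1) s = 1) (s : ℤ × Fin m) (A : Set (ℤ × Fin m)) :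
    P s {ω | ω (sigmaT 0 ω + 1) ∈ A} = ∑' r, A.indicator 1 r * Ex K (fun u => K u r) s := by
  have hA : MeasurableSet {ω : ℕ → ℤ × Fin m | ω 0 ∈ A} :=
    measurable_pi_apply 0 (MeasurableSet.of_discrete)
  have hA1 : MeasurableSet (sh ⁻¹' {ω : ℕ → ℤ × Fin m | ω 0 ∈ A}) := measurable_sh hA
  have e1 : ∀ t, P t {ω : ℕ → ℤ × Fin m | ω 0 ∈ A} = A.indicator 1 t := by
    intro t
    have := hprob t
    by_cases ht : t ∈ A
    · rw [Set.indicator_of_mem ht, Pi.one_apply, ← measure_univ (μ := P t)]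
      apply measure_congr
      filter_upwards [ae0 K P hprob hcyl t] with ω hω
      apply propext
      change ω 0 ∈ A ↔ True
      simp [hω, ht]
    · rw [Set.indicator_of_notMem ht, measure_eq_zero_iff_ae_notMem]
      filter_upwards [ae0 K P hprob hcyl t] with ω hω
      simp [hω, ht]
  have e2 : P s {ω | ω (sigmaT 0 ω + 1) ∈ A} = P s (⋃ n, EvN n (sh ⁻¹' {ω | ω 0 ∈ A})) := by
    apply measure_congr
    filter_upwards [exit_ae K P hprob hcyl hone s] with ω hω
    apply propext
    obtain ⟨n, h1, h2, _⟩ := Set.mem_iUnion.1 hω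
    have hs := sigma0_eq ω n h1 h2
    change ω (sigmaT 0 ω + 1) ∈ A ↔ ω ∈ ⋃ n, EvN n (sh ⁻¹' {ω | ω 0 ∈ A})
    rw [hs, Set.mem_iUnion]
    constructor
    · intro h
      refine ⟨n, h1, h2, ?_⟩
      change ω (0 + 1 + n) ∈ A
      rwa [show 0 + 1 + n = n + 1 by omega]
    · rintro ⟨k, h3, h4, h5⟩
      have : k = n := (sigma0_eq ω k h3 h4).symm.trans hs
      subst this
      change ω (0 + 1 + k) ∈ A at h5
      rwa [show 0 + 1 + k = k + 1 by omega] at h5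
  rw [e2, P_Ev K P hprob hcyl _ hA1]
  simp_rw [markov K P hprob hcyl _ _ hA, e1]
  rw [← Ex_tsum]
  congr 1
  funext u
  exact tsum_congr fun t => mul_comm _ _

/-- law of the exit chain -/
lemma exit_law (hone : ∀ s, Ex K (fun _ => 1) s = 1) (s : ℤ × Fin m) (hs : s.1 ≤ 0)
    (A : Set (ℤ × Fin m)) :
    P s {ω | ω (sigmaT 1 ω) ∈ A} =
      ∑' u, A.indicator 1 u * ∑' t, K s t * Ex K (dl u) t := by
  have hA : MeasurableSet {ω : ℕ → ℤ × Fin m | ω 0 ∈ A} :=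
    measurable_pi_apply 0 (MeasurableSet.of_discrete)
  have e1 : ∀ t, P t {ω : ℕ → ℤ × Fin m | ω 0 ∈ A} = A.indicator 1 t := by
    intro t
    have := hprob t
    by_cases ht : t ∈ A
    · rw [Set.indicator_of_mem ht, Pi.one_apply, ← measure_univ (μ := P t)]
      apply measure_congr
      filter_upwards [ae0 K P hprob hcyl t] with ω hω
      apply propext
      change ω 0 ∈ A ↔ True
      simp [hω, ht]
    · rw [Set.indicator_of_notMem ht, measure_eq_zero_iff_ae_notMem]
      filter_upwards [ae0 K P hprob hcyl t] with ω hω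
      simp [hω, ht]
  have hU : MeasurableSet (⋃ n, EvN n (Set.univ : Set (ℕ → ℤ × Fin m))) :=
    MeasurableSet.iUnion fun n => measurable_EvN n _ MeasurableSet.univ
  have hae : ∀ᵐ ω ∂(P s), sh ω ∈ ⋃ n, EvN n Set.univ := by
    have h := markov K P hprob hcyl s _ hU.compl
    have h0 : ∀ t, P t (⋃ n, EvN n Set.univ)ᶜ = 0 := fun t => exit_ae K P hprob hcyl hone t
    simp only [h0, mul_zero, tsum_zero] at h
    exact h
  have e2 : P s {ω | ω (sigmaT 1 ω) ∈ A} = P s (sh ⁻¹' ⋃ n, EvN n {ω | ω 0 ∈ A}) := by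
    apply measure_congr
    filter_upwards [hae, ae0 K P hprob hcyl s] with ω hω h0
    apply propext
    obtain ⟨n, h1, h2, _⟩ := Set.mem_iUnion.1 hω
    have hs1 := sigma1_eq ω n (by rw [h0]; exact hs) h1 h2
    change ω (sigmaT 1 ω) ∈ A ↔ sh ω ∈ ⋃ n, EvN n {ω | ω 0 ∈ A}
    rw [hs1, Set.mem_iUnion]
    constructor
    · intro h
      refine ⟨n, h1, h2, ?_⟩
      change ω (0 + n + 1) ∈ A
      rwa [zero_add]
    · rintro ⟨k, h3, h4, h5⟩
      have : k = n := (sigma0_eq _ k h3 h4).symm.trans (sigma0_eq _ n h1 h2)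
      subst this
      change ω (0 + k + 1) ∈ A at h5
      rwa [zero_add] at h5
  rw [e2, markov K P hprob hcyl _ _ (MeasurableSet.iUnion fun n => measurable_EvN n _ hA)]
  simp_rw [P_Ev K P hprob hcyl _ hA, e1]
  simp_rw [Ex_expand K (fun u => A.indicator 1 u), ← ENNReal.tsum_mul_left]
  rw [ENNReal.tsum_comm]
  refine tsum_congr fun u => tsum_congr fun t => by ring

end markov

lemma moments (ξ : PMF ℤ) (v : ℝ) (hv : 0 < v)
    (hint : Summable fun y : ℤ => |(y : ℝ)| * (ξ y).toReal)
    (hmean : ∑' y : ℤ, (y : ℝ) * (ξ y).toReal = 0)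
    (hsq : Summable fun y : ℤ => (y : ℝ) ^ 2 * (ξ y).toReal)
    (hvar : v ^ 2 = ∑' y : ℤ, (y : ℝ) ^ 2 * (ξ y).toReal) :
    ∃ k0 : ℝ≥0∞, k0 ≠ ⊤ ∧ k0 ≠ 0 ∧ ∑' z : ℤ, ξ z * ((-z).toNat : ℝ≥0∞) = k0 ∧
      ∑' z : ℤ, ξ z * (z.toNat : ℝ≥0∞) = k0 ∧
      ∑' z : ℤ, ξ z * ((z.natAbs ^ 2 : ℕ) : ℝ≥0∞) ≠ ⊤ := by
  have conv : ∀ n : ℤ → ℕ, (Summable fun z => (n z : ℝ) * (ξ z).toReal) →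
      ∑' z : ℤ, ξ z * (n z : ℝ≥0∞) = ENNReal.ofReal (∑' z, (n z : ℝ) * (ξ z).toReal) := by
    intro n hn
    rw [ENNReal.ofReal_tsum_of_nonneg (fun z => by positivity) hn]
    refine tsum_congr fun z => ?_
    rw [ENNReal.ofReal_mul (by positivity), ENNReal.ofReal_toReal (ξ.apply_ne_top z), mul_comm]
    simp
  have habs : ∀ z : ℤ, ((z.toNat : ℝ) ≤ |(z:ℝ)|) ∧ (((-z).toNat : ℝ) ≤ |(z:ℝ)|) ∧
      (z : ℝ) = (z.toNat : ℝ) - ((-z).toNat : ℝ) := by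
    intro z
    have h1 : (z.toNat : ℤ) ≤ |z| := by rw [Int.abs_eq_natAbs]; omega
    have h2 : ((-z).toNat : ℤ) ≤ |z| := by rw [Int.abs_eq_natAbs]; omega
    have h3 : z = (z.toNat : ℤ) - ((-z).toNat : ℤ) := by omega
    refine ⟨by exact_mod_cast h1, by exact_mod_cast h2, by exact_mod_cast h3⟩
  have s1 : Summable fun z : ℤ => (z.toNat : ℝ) * (ξ z).toReal :=
    Summable.of_nonneg_of_le (fun z => by positivity)
      (fun z => mul_le_mul_of_nonneg_right (habs z).1 ENNReal.toReal_nonneg) hint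
  have s2 : Summable fun z : ℤ => ((-z).toNat : ℝ) * (ξ z).toReal :=
    Summable.of_nonneg_of_le (fun z => by positivity)
      (fun z => mul_le_mul_of_nonneg_right (habs z).2.1 ENNReal.toReal_nonneg) hint
  have heq : ∑' z : ℤ, (z.toNat : ℝ) * (ξ z).toReal = ∑' z : ℤ, ((-z).toNat : ℝ) * (ξ z).toReal := by
    have : ∑' y : ℤ, (y : ℝ) * (ξ y).toReal =
        ∑' z : ℤ, (z.toNat : ℝ) * (ξ z).toReal - ∑' z : ℤ, ((-z).toNat : ℝ) * (ξ z).toReal := by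
      rw [← s1.tsum_sub s2]
      refine tsum_congr fun z => ?_
      rw [← sub_mul, ← (habs z).2.2]
    linarith
  have c1 := conv (fun z => z.toNat) s1
  have c2 := conv (fun z => (-z).toNat) s2
  have hc : ∑' z : ℤ, ξ z * (z.toNat : ℝ≥0∞) = ∑' z : ℤ, ξ z * ((-z).toNat : ℝ≥0∞) := by
    rw [c1, c2, heq]
  refine ⟨_, ?_, ?_, rfl, hc, ?_⟩
  · rw [c2]; simp
  · intro h0
    have h0' := h0
    rw [← hc] at h0'
    rw [ENNReal.tsum_eq_zero] at h0 h0'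
    have : ∀ y : ℤ, (y : ℝ) ^ 2 * (ξ y).toReal = 0 := by
      intro y
      rcases eq_or_ne y 0 with rfl | hy
      · simp
      · have a := h0 y
        have b := h0' y
        have : ξ y = 0 := by
          rcases mul_eq_zero.1 a with h | h
          · exact h
          · rcases mul_eq_zero.1 b with h' | h'
            · exact h'
            · have h1 : (-y).toNat = 0 := by exact_mod_cast h
              have h2 : y.toNat = 0 := by exact_mod_cast h'
              omega
        simp [this]
    simp only [this, tsum_zero] at hvar
    nlinarith
  · have e : ∀ z : ℤ, ((z.natAbs ^ 2 : ℕ) : ℝ) = (z:ℝ)^2 := by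
      intro z
      rw [Nat.cast_pow, Nat.cast_natAbs]
      simp
    rw [conv (fun z => z.natAbs ^ 2) (by simp_rw [e]; exact hsq)]
    simp

lemma meas_kernel_iff {S : Type*} [MeasurableSpace S] [Countable S] [MeasurableSingletonClass S]
    (π : Measure S) (R : S → S → ℝ≥0∞) :
    (∀ A : Set S, ∑' s, π {s} * ∑' r, A.indicator 1 r * R s r = π A) ↔
      ∀ r, ∑' s, π {s} * R s r = π {r} := by
  constructor
  · intro h r
    rw [← h {r}]
    refine tsum_congr fun s => ?_
    congr 1
    rw [tsum_eq_single r]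
    · simp
    · intro b hb; simp [hb]
  · intro h A
    have : π A = ∑' r, A.indicator 1 r * π {r} := by
      rw [← Measure.tsum_indicator_apply_singleton π A (MeasurableSet.of_discrete)]
      refine tsum_congr fun r => ?_
      by_cases hr : r ∈ A <;> simp [hr]
    rw [this]
    have h' : ∀ r, A.indicator 1 r * π {r} = ∑' s, A.indicator 1 r * (π {s} * R s r) := by
      intro r; rw [ENNReal.tsum_mul_left, h]
    simp_rw [h', ← ENNReal.tsum_mul_left]
    rw [ENNReal.tsum_comm]
    refine tsum_congr fun u => tsum_congr fun t => by ring

lemma meas_prob_iff {S : Type*} [MeasurableSpace S] [Countable S] [MeasurableSingletonClass S]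
    (π : Measure S) : IsProbabilityMeasure π ↔ ∑' s, π {s} = 1 := by
  have : π Set.univ = ∑' s, π {s} := by
    rw [← Measure.tsum_indicator_apply_singleton π Set.univ MeasurableSet.univ]
    simp
  rw [← this]
  exact ⟨fun h => h.measure_univ, fun h => ⟨h⟩⟩

lemma meas_zero_iff {S : Type*} [MeasurableSpace S] [Countable S] [MeasurableSingletonClass S]
    (π : Measure S) (p : S → Prop) : π {s | p s} = 0 ↔ ∀ s, p s → π {s} = 0 := by
  constructor
  · intro h s hs
    exact measure_mono_null (by simpa using hs) h
  · intro h
    rw [← Measure.tsum_indicator_apply_singleton π _ (MeasurableSet.of_discrete)]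
    rw [ENNReal.tsum_eq_zero]
    intro s
    by_cases hs : p s
    · simp [Set.indicator, h s hs]
    · simp [Set.indicator, hs]

lemma exists_meas {S : Type*} [MeasurableSpace S] [Countable S] [MeasurableSingletonClass S]
    (p : S → ℝ≥0∞) : ∃ π : Measure S, ∀ s, π {s} = p s := by
  classical
  refine ⟨Measure.sum (fun s => p s • Measure.dirac s), fun s => ?_⟩
  rw [Measure.sum_apply _ (measurableSet_singleton s), tsum_eq_single s]
  · simp
  · intro b hb; simp [hb]

/-- the exit kernel sums -/
lemma Ex_dl_sum {m : ℕ} (K : ℤ × Fin m → PMF (ℤ × Fin m)) (s : ℤ × Fin m) :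
    ∑' u, Ex K (dl u) s = Ex K (fun _ => 1) s := by
  rw [Ex_expand K (fun _ => 1)]; simp

lemma Ex_congr {m : ℕ} (K : ℤ × Fin m → PMF (ℤ × Fin m)) (f f' : ℤ × Fin m → ℝ≥0∞)
    (h : ∀ u, u.1 ≤ 0 → f u = f' u) (s : ℤ × Fin m) : Ex K f s = Ex K f' s := by
  have : ∀ n s, exN K f n s = exN K f' n s := by
    intro n
    induction n with
    | zero =>
      intro s
      by_cases hs : s.1 ≤ 0
      · simp [exN, hs, h s hs]
      · simp [exN, hs]
    | succ n ih => intro s; simp [exN, ih]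
  simp only [Ex, this]

lemma Ex_zero {m : ℕ} (K : ℤ × Fin m → PMF (ℤ × Fin m)) (f : ℤ × Fin m → ℝ≥0∞)
    (h : ∀ u, u.1 ≤ 0 → f u = 0) (s : ℤ × Fin m) : Ex K f s = 0 :=
  le_antisymm (Ex_min K f (fun _ => 0) (fun s hs => (h s hs).le) (fun s _ => by simp) s) bot_le

/-- reachability for the entrance kernel -/
lemma reach {m : ℕ} (K : ℤ × Fin m → PMF (ℤ × Fin m)) (s0 t0 : ℤ × Fin m)
    (h0 : Ex K (fun u => K u t0) s0 ≠ 0) (n : ℕ) (s r : ℤ × Fin m) (hn : iterK K n s r ≠ 0)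
    (hr : Relation.TransGen (fun a b => Ex K (fun u => K u b) a ≠ 0) r t0) :
    Relation.TransGen (fun a b => Ex K (fun u => K u b) a ≠ 0) s t0 := by
  have step : ∀ a b, K a b ≠ 0 →
      Relation.TransGen (fun a b => Ex K (fun u => K u b) a ≠ 0) b t0 →
      Relation.TransGen (fun a b => Ex K (fun u => K u b) a ≠ 0) a t0 := by
    intro a b hab hb
    by_cases ha : a.1 ≤ 0
    · refine Relation.TransGen.head ?_ hb
      rw [Ex_nonpos _ _ _ ha]
      exact hab
    · have key : ∀ c, Ex K (fun u => K u c) b ≠ 0 → Ex K (fun u => K u c) a ≠ 0 := by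
        intro c hc h
        rw [Ex_pos _ _ _ (by omega), ENNReal.tsum_eq_zero] at h
        exact mul_ne_zero hab hc (h b)
      rcases Relation.TransGen.head'_iff.1 hb with ⟨c, hc, hct⟩
      exact Relation.TransGen.head'_iff.2 ⟨c, key c hc, hct⟩
  induction n generalizing r with
  | zero =>
    have : r = s := by
      by_contra hne
      exact hn (by simp [iterK, hne])
    rwa [← this]
  | succ n ih =>
    rw [iterK, PMF.bind_apply] at hn
    obtain ⟨q, hq⟩ : ∃ q, iterK K n s q * K q r ≠ 0 := by
      by_contra hcon
      push Not at hcon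
      exact hn (by simp [hcon])
    exact ih q (left_ne_zero_of_mul hq) (step q r (right_ne_zero_of_mul hq) hr)

lemma drift_V {m : ℕ} (K : ℤ × Fin m → PMF (ℤ × Fin m)) (ξ : Fin m → PMF ℤ)
    (hA1 : ∀ x : ℤ, 1 ≤ x → ∀ (i : Fin m) (y : ℤ), K (x, i) (x + y, i) = ξ i y)
    (hA2 : ∀ x : ℤ, x ≤ 0 → ∀ i : Fin m, ∀ s' : ℤ × Fin m, K (x, i) s' ≠ 0 → 1 ≤ s'.1)
    (C : ℝ) (hC : 0 < C)
    (hA3 : ∀ x : ℤ, x ≤ 0 → ∀ i : Fin m,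
      ∑' s' : ℤ × Fin m, (s'.1.toNat : ℝ≥0∞) * K (x, i) s' ≤
        ENNReal.ofReal (C * (1 + |(x : ℝ)|)))
    (g : Fin m → ℤ → ℝ≥0∞)
    (hg : ∀ i x, 1 ≤ x → ∑' z, ξ i z * g i (x+z) < g i x)
    (hgneg : ∀ i x, x ≤ 0 → ((-x).toNat : ℝ≥0∞) ≤ 2 * g i x)
    (hglin : ∀ i, ∀ η : ℝ≥0∞, η ≠ 0 → ∃ D : ℝ≥0∞, D ≠ ⊤ ∧
      ∀ x, 1 ≤ x → g i x ≤ η * (x.toNat : ℝ≥0∞) + D) :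
    ∃ D : ℝ≥0∞, D ≠ ⊤ ∧ ∀ s : ℤ × Fin m,
      ∑' t, Ex K (fun u => K u t) s * (if 1 ≤ t.1 then (t.1.toNat : ℝ≥0∞) else ⊤) ≤
        (if 1 ≤ s.1 then (s.1.toNat : ℝ≥0∞) else ⊤) / 2 + D := by
  set c := ENNReal.ofReal C with hc
  have hc0 : c ≠ 0 := by simpa [hc] using hC
  have hct : c ≠ ⊤ := by simp [hc]
  choose D hDt hD using fun i => hglin i (2 * c * 2)⁻¹ (by simp [ENNReal.mul_eq_top, hct])
  refine ⟨c + 2 * c * ∑ i, D i, ?_, ?_⟩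
  · exact ENNReal.add_ne_top.2 ⟨hct, ENNReal.mul_ne_top (ENNReal.mul_ne_top (by simp) hct)
      (ENNReal.sum_ne_top.2 fun i _ => hDt i)⟩
  rintro ⟨x, i⟩
  by_cases hx : 1 ≤ x
  swap
  · simp [hx, ENNReal.top_div]
  simp only [hx, if_true]
  have e1 : ∑' t, Ex K (fun u => K u t) (x, i) * (if 1 ≤ t.1 then (t.1.toNat : ℝ≥0∞) else ⊤) =
      Ex K (fun u => ∑' t : ℤ × Fin m, (if 1 ≤ t.1 then (t.1.toNat : ℝ≥0∞) else ⊤) * K u t) (x, i) := by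
    rw [Ex_tsum]
    exact tsum_congr fun t => mul_comm _ _
  have e2 : Ex K (fun u => ∑' t : ℤ × Fin m, (if 1 ≤ t.1 then (t.1.toNat : ℝ≥0∞) else ⊤) * K u t) (x, i)
      ≤ c + 2 * c * g i x := by
    refine Ex_min K _ (fun s => c + 2 * c * g s.2 s.1) ?_ ?_ (x, i)
    · rintro ⟨y, j⟩ hy
      have hy' : y ≤ 0 := hy
      calc ∑' t : ℤ × Fin m, (if 1 ≤ t.1 then (t.1.toNat : ℝ≥0∞) else ⊤) * K (y, j) t
          = ∑' t : ℤ × Fin m, (t.1.toNat : ℝ≥0∞) * K (y, j) t := by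
            refine tsum_congr fun t => ?_
            by_cases hk : K (y, j) t = 0
            · simp [hk]
            · rw [if_pos (hA2 y hy' j t hk)]
        _ ≤ ENNReal.ofReal (C * (1 + |(y : ℝ)|)) := hA3 y hy' j
        _ = c + c * ((-y).toNat : ℝ≥0∞) := by
            have : |(y:ℝ)| = (((-y).toNat : ℕ) : ℝ) := by
              have : |y| = (((-y).toNat : ℕ) : ℤ) := by rw [Int.abs_eq_natAbs]; omega
              exact_mod_cast this
            rw [this, mul_add, mul_one, ENNReal.ofReal_add hC.le (by positivity),
              ENNReal.ofReal_mul hC.le]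
            simp [hc]
        _ ≤ c + c * (2 * g j y) := by gcongr; exact hgneg j y hy'
        _ = _ := by ring
    · rintro ⟨y, j⟩ hy
      have hy' : 1 ≤ y := hy
      rw [K_sum K ξ hA1 y hy' j]
      simp_rw [mul_add, ENNReal.tsum_add, ENNReal.tsum_mul_right, (ξ j).tsum_coe, one_mul,
          mul_left_comm _ (2 * c), ENNReal.tsum_mul_left]
      gcongr
      exact (hg j y hy').le
  rw [e1]
  refine e2.trans ?_
  have h2c0 : 2 * c ≠ 0 := mul_ne_zero (by simp) hc0
  have h2ct : 2 * c ≠ ⊤ := ENNReal.mul_ne_top (by simp) hct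
  calc c + 2 * c * g i x ≤ c + 2 * c * ((2 * c * 2)⁻¹ * x.toNat + ∑ i, D i) := by
        gcongr
        refine (hD i x hx).trans ?_
        gcongr
        exact Finset.single_le_sum (f := D) (fun _ _ => bot_le) (Finset.mem_univ i)
    _ = c + ((2 * c * (2*c)⁻¹) * 2⁻¹ * x.toNat + 2 * c * ∑ i, D i) := by
        rw [ENNReal.mul_inv (Or.inl h2c0) (Or.inl h2ct)]; ring
    _ = _ := by
        rw [ENNReal.mul_inv_cancel h2c0 h2ct, one_mul, div_eq_mul_inv]; ring

/-- The embedded exit and entrance Markov chains have unique stationary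
distributions `π_exit` and `π_entrance`. -/
theorem stmt_0
    (m : ℕ) (hm : 1 ≤ m)
    (K : ℤ × Fin m → PMF (ℤ × Fin m))
    (P : ℤ × Fin m → Measure (ℕ → ℤ × Fin m))
    (hprob : ∀ s, IsProbabilityMeasure (P s))
    -- `P s` is the law of the Markov chain with kernel `K` started at `s`
    (hcyl : ∀ (s : ℤ × Fin m) (n : ℕ) (path : ℕ → ℤ × Fin m),
      P s {ω | ∀ k ≤ n, ω k = path k} =
        (if path 0 = s then 1 else 0) *
          ∏ k ∈ Finset.range n, K (path k) (path (k + 1)))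
    -- (A1): on `ℕ × {i}` the radius jumps like a centered square-integrable
    -- 1-arithmetic random walk with step distribution `ξ i`, variance `(v i)²`
    (ξ : Fin m → PMF ℤ) (v : Fin m → ℝ) (hv : ∀ i, 0 < v i)
    (hA1 : ∀ x : ℤ, 1 ≤ x → ∀ (i : Fin m) (y : ℤ), K (x, i) (x + y, i) = ξ i y)
    (hint : ∀ i, Summable fun y : ℤ => |(y : ℝ)| * (ξ i y).toReal)
    (hmean : ∀ i, ∑' y : ℤ, (y : ℝ) * (ξ i y).toReal = 0)
    (hsq : ∀ i, Summable fun y : ℤ => (y : ℝ) ^ 2 * (ξ i y).toReal)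
    (hvar : ∀ i, (v i) ^ 2 = ∑' y : ℤ, (y : ℝ) ^ 2 * (ξ i y).toReal)
    (harith : ∀ i, ∀ n : ℕ, 1 ≤ n →
      (∀ y : ℤ, ξ i y ≠ 0 → (n : ℤ) ∣ y) → n = 1)
    -- (A2): from a non-positive radius the chain jumps to `ℕ × {1,…,m}` a.s.
    (hA2 : ∀ x : ℤ, x ≤ 0 → ∀ i : Fin m, ∀ s' : ℤ × Fin m,
      K (x, i) s' ≠ 0 → 1 ≤ s'.1)
    -- (A3): `E[R(1) | 𝒳(0) = (x,i)] ≤ C (1 + |x|)` for `x ≤ 0`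
    (C : ℝ) (hC : 0 < C)
    (hA3 : ∀ x : ℤ, x ≤ 0 → ∀ i : Fin m,
      ∑' s' : ℤ × Fin m, (s'.1.toNat : ℝ≥0∞) * K (x, i) s' ≤
        ENNReal.ofReal (C * (1 + |(x : ℝ)|)))
    -- (A4): the states `ℕ × {1,…,m}` communicate
    (hA4 : ∀ s s' : ℤ × Fin m, 1 ≤ s.1 → 1 ≤ s'.1 → ∃ n : ℕ, iterK K n s s' ≠ 0)
    :
    (∃! π : Measure (ℤ × Fin m), ExitStationary P π) ∧
    (∃! π : Measure (ℤ × Fin m), EntranceStationary P π) := by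
  classical
  have hlyap : ∀ i, ∃ g : ℤ → ℝ≥0∞, (∀ x, g x ≠ ⊤) ∧ (∀ x, 1 ≤ x → ∑' z, ξ i z * g (x+z) < g x) ∧
      (∀ x, x ≤ 0 → ((-x).toNat : ℝ≥0∞) ≤ 2 * g x) ∧
      (∀ η : ℝ≥0∞, η ≠ 0 → ∃ D : ℝ≥0∞, D ≠ ⊤ ∧ ∀ x, 1 ≤ x → g x ≤ η * (x.toNat : ℝ≥0∞) + D) ∧
      (∀ M : ℝ≥0∞, M ≠ ⊤ → ∃ x0 : ℤ, ∀ x, x0 ≤ x → M < g x) := by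
    intro i
    obtain ⟨k0, h1, h2, h3, h4, h5⟩ := moments (ξ i) (v i) (hv i) (hint i) (hmean i) (hsq i) (hvar i)
    exact lyap (ξ i) k0 h1 h2 h3 h4 h5
  choose g hgt hg hgneg hglin hginf using hlyap
  have hone : ∀ s, Ex K (fun _ => 1) s = 1 := Ex_one K ξ hA1 g hgt hg hginf
  obtain ⟨D, hDt, hdrift⟩ := drift_V K ξ hA1 hA2 C hC hA3 g hg hgneg hglin
  set Q : ℤ × Fin m → ℤ × Fin m → ℝ≥0∞ := fun s r => Ex K (fun u => K u r) s with hQdef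
  have hQ : ∀ s, ∑' r, Q s r = 1 := by
    intro s
    have := Ex_tsum K (fun _ => 1) (fun r u => K u r) s
    simp only [one_mul, PMF.tsum_coe, hone] at this
    exact this.symm
  have hQ0 : ∀ s r, r.1 ≤ 0 → Q s r = 0 := by
    intro s r hr
    refine Ex_zero K _ (fun u hu => ?_) s
    by_contra hne
    have := hA2 u.1 hu u.2 r hne
    omega
  have hQB : ∀ s r, Q s r = ∑' u, Ex K (dl u) s * K u r := by
    intro s r
    simp only [hQdef]
    rw [Ex_expand]
    exact tsum_congr fun u => mul_comm _ _
  have hB0 : ∀ s u, 1 ≤ u.1 → Ex K (dl u) s = 0 := by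
    intro s u hu
    refine Ex_zero K _ (fun w hw => ?_) s
    have : w ≠ u := by rintro rfl; omega
    simp [dl, this]
  have hB1 : ∀ s, ∑' u, Ex K (dl u) s = 1 := fun s => by rw [Ex_dl_sum, hone]
  -- reachable entrance state
  let s0 : ℤ × Fin m := (1, ⟨0, hm⟩)
  obtain ⟨t0, ht0⟩ : ∃ t0, Q s0 t0 ≠ 0 := by
    by_contra hcon
    push Not at hcon
    have := hQ s0
    simp [hcon] at this
  have hreachpos : ∀ s : ℤ × Fin m, 1 ≤ s.1 →
      Relation.TransGen (fun a b => Q a b ≠ 0) s t0 := by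
    intro s hs
    obtain ⟨n, hn⟩ := hA4 s s0 hs le_rfl
    exact reach K s0 t0 ht0 n s s0 hn (Relation.TransGen.single ht0)
  have hreach : ∀ s : ℤ × Fin m, Relation.TransGen (fun a b => Q a b ≠ 0) s t0 := by
    intro s
    obtain ⟨t, ht⟩ : ∃ t, Q s t ≠ 0 := by
      by_contra hcon
      push Not at hcon
      have := hQ s
      simp [hcon] at this
    refine Relation.TransGen.head ht (hreachpos t ?_)
    by_contra hc
    exact ht (hQ0 s t (by omega))
  -- existence
  obtain ⟨p, hp1, hps⟩ := stat_exists Q hQ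
    (fun s => if 1 ≤ s.1 then (s.1.toNat : ℝ≥0∞) else ⊤) D hDt hdrift (by
      intro M hM
      obtain ⟨N, hN⟩ := ENNReal.exists_nat_gt hM
      refine ((Set.finite_Icc (1:ℤ) N).prod (Set.finite_univ (α := Fin m))).subset ?_
      rintro ⟨x, i⟩ hx
      by_cases h1 : 1 ≤ x
      · have hx' : (if 1 ≤ x then (x.toNat : ℝ≥0∞) else ⊤) ≤ M := hx
        rw [if_pos h1] at hx'
        have : x.toNat < N := by exact_mod_cast hx'.trans_lt hN
        refine ⟨⟨h1, ?_⟩, trivial⟩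
        change x ≤ N
        omega
      · have hx' : (if 1 ≤ x then (x.toNat : ℝ≥0∞) else ⊤) ≤ M := hx
        rw [if_neg h1] at hx'
        exact absurd (top_le_iff.1 hx') hM) s0 (by simp [s0])
  have hent : ∀ π : Measure (ℤ × Fin m), EntranceStationary P π ↔
      (∑' s, π {s} = 1 ∧ (∀ s : ℤ × Fin m, s.1 ≤ 0 → π {s} = 0) ∧
        ∀ r, ∑' s, π {s} * Q s r = π {r}) := by
    intro π
    rw [EntranceStationary, meas_prob_iff, meas_zero_iff, ← meas_kernel_iff]
    simp_rw [entrance_law K P hprob hcyl hone]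
    rfl
  set R : ℤ × Fin m → ℤ × Fin m → ℝ≥0∞ := fun s u => ∑' t, K s t * Ex K (dl u) t with hRdef
  have hexi : ∀ π : Measure (ℤ × Fin m), ExitStationary P π ↔
      (∑' s, π {s} = 1 ∧ (∀ s : ℤ × Fin m, 1 ≤ s.1 → π {s} = 0) ∧
        ∀ r, ∑' s, π {s} * R s r = π {r}) := by
    intro π
    rw [ExitStationary, meas_prob_iff, meas_zero_iff, ← meas_kernel_iff]
    refine and_congr_right fun _ => and_congr_right fun h0 => ?_
    refine forall_congr' fun A => ?_
    have : ∀ s, π {s} * P s {ω | ω (sigmaT 1 ω) ∈ A} =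
        π {s} * ∑' r, A.indicator 1 r * R s r := by
      intro s
      by_cases hs : s.1 ≤ 0
      · rw [exit_law K P hprob hcyl hone s hs]
      · rw [h0 s (by omega)]; simp
    simp_rw [this]
  -- pushing back and forth
  have hRsplit : ∀ (q : ℤ × Fin m → ℝ≥0∞) u,
      ∑' s, q s * R s u = ∑' t, (∑' s, q s * K s t) * Ex K (dl u) t := by
    intro q u
    simp only [hRdef, ← ENNReal.tsum_mul_left, ← ENNReal.tsum_mul_right]
    rw [ENNReal.tsum_comm]
    simp only [mul_assoc]
  have hQsplit : ∀ (q : ℤ × Fin m → ℝ≥0∞) r,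
      ∑' s, q s * Q s r = ∑' u, (∑' s, q s * Ex K (dl u) s) * K u r := by
    intro q u
    simp only [hQB, ← ENNReal.tsum_mul_left, ← ENNReal.tsum_mul_right]
    rw [ENNReal.tsum_comm]
    simp only [mul_assoc]
  constructor
  · obtain ⟨π, hπ⟩ := exists_meas (fun u => ∑' s, p s * Ex K (dl u) s)
    refine ⟨π, (hexi π).2 ⟨?_, ?_, ?_⟩, ?_⟩
    · simp_rw [hπ]
      rw [tsum_push (Q := fun s u => Ex K (dl u) s) hB1, hp1]
    · intro u hu
      rw [hπ]
      simp [hB0 _ u hu]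
    · intro u
      rw [hRsplit]
      simp_rw [hπ, ← hQsplit, hps]
    · intro π' hπ'
      obtain ⟨a1, a2, a3⟩ := (hexi π').1 hπ'
      have hpp : (fun r => ∑' s, π' {s} * K s r) = p := by
        refine stat_unique Q hQ t0 hreach _ p ?_ hp1 ?_ hps
        · rw [tsum_push (Q := fun s r => K s r) (fun s => (K s).tsum_coe), a1]
        · intro r
          rw [hQsplit]
          simp_rw [← hRsplit, a3]
      refine Measure.ext_of_singleton fun u => ?_
      rw [hπ, ← a3 u, hRsplit]
      exact tsum_congr fun t => by rw [← hpp]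
  · obtain ⟨π, hπ⟩ := exists_meas p
    refine ⟨π, (hent π).2 ⟨?_, ?_, ?_⟩, ?_⟩
    · simp_rw [hπ]; exact hp1
    · intro s hs
      rw [hπ, ← hps s]
      simp [hQ0 _ s hs]
    · intro r
      simp_rw [hπ]; exact hps r
    · intro π' hπ'
      obtain ⟨a1, a2, a3⟩ := (hent π').1 hπ'
      have := stat_unique Q hQ t0 hreach (fun s => π' {s}) p a1 hp1 a3 hps
      refine Measure.ext_of_singleton fun u => ?_
      rw [hπ, ← this]
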